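/- Let d ≥ 1, p ∈ [4, ∞), β ∈ (0, 2] and L > 0. Then for every sequence {b_n : n ∈ ℕ} with b_n ∈ (0,1), the Dirichlet kernel density estimators satisfy liminf_{n→∞} [ sup_{f ∈ Σ(d,β,L)} (E_f ‖f̂_{n,b_n} − f‖_p^p)^{1/p} ] / n^{−β/(d+2β)} = ∞; i.e., the estimator is never minimax over Σ(d,β,L) under the L^p loss when p ≥ 4. -/

import Mathlib

open MeasureTheory Filter Topology
open scoped ENNReal BigOperators

noncomputable section

/-- The d-dimensional simplex `S_d = {s ∈ [0,1]^d : s_1 + ⋯ + s_d ≤ 1}`. -/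
def Sd (d : ℕ) : Set (Fin d → ℝ) :=
  {s | (∀ i, 0 ≤ s i ∧ s i ≤ 1) ∧ ∑ i, s i ≤ 1}

/-- The Dirichlet density `K_{u,v}` on `S_d` (0 outside). -/
def dirK (d : ℕ) (u : Fin d → ℝ) (v : ℝ) : (Fin d → ℝ) → ℝ :=
  Set.indicator (Sd d)
    (fun s => Real.Gamma (v + ∑ i, u i) / (Real.Gamma v * ∏ i, Real.Gamma (u i)) *
      (1 - ∑ i, s i) ^ (v - 1) * ∏ i, (s i) ^ (u i - 1))

/-- The Dirichlet kernel `K_{s/b+1, (1-‖s‖₁)/b+1}` at location `s` with bandwidth `b`. -/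
def dirKb (d : ℕ) (b : ℝ) (s : Fin d → ℝ) : (Fin d → ℝ) → ℝ :=
  dirK d (fun i => s i / b + 1) ((1 - ∑ i, s i) / b + 1)

/-- The Dirichlet kernel density estimator based on the sample `X`. -/
def fhat (d n : ℕ) (b : ℝ) (X : Fin n → Fin d → ℝ) (s : Fin d → ℝ) : ℝ :=
  (n : ℝ)⁻¹ * ∑ i, dirKb d b s (X i)

/-- `m` = the largest integer strictly less than `β` (for `β > 0`). -/
def mOf (β : ℝ) : ℕ := ⌈β⌉₊ - 1

/-- Partial derivative of order `j` in the directions `v` (on the interior of the simplex). -/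
def Dpartial (d j : ℕ) (f : (Fin d → ℝ) → ℝ) (v : Fin j → Fin d) (s : Fin d → ℝ) : ℝ :=
  iteratedFDerivWithin ℝ j f (interior (Sd d)) s fun i => Pi.single (v i) 1

/-- The Hölder class `Σ(d, β, L)` of probability densities supported on `S_d`. -/
def holderClass (d : ℕ) (β L : ℝ) : Set ((Fin d → ℝ) → ℝ) :=
  {f | (∀ s, 0 ≤ f s) ∧ (∀ s, s ∉ Sd d → f s = 0) ∧ (∫ s in Sd d, f s) = 1 ∧
    ContDiffOn ℝ (mOf β) f (interior (Sd d)) ∧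
    ∀ v : Fin (mOf β) → Fin d, ∀ s ∈ interior (Sd d), ∀ t ∈ interior (Sd d),
      |Dpartial d (mOf β) f v s - Dpartial d (mOf β) f v t| ≤
        L * (∑ i, |s i - t i|) ^ (β - (mOf β : ℝ))}

/-- `E_f ‖f̂_{n,b} − f‖_p^p`: expectation, under i.i.d. sampling of `X_1, …, X_n` from the
density `f`, of the `p`-th power of the `L^p` distance between `f̂_{n,b}` and `f` on `S_d`. -/
def lpRiskPow (d n : ℕ) (b p : ℝ) (f : (Fin d → ℝ) → ℝ) : ℝ :=
  ∫ ω : Fin n → Fin d → ℝ,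
    (∏ i, f (ω i)) * ∫ s in Sd d, |fhat d n b ω s - f s| ^ p

lemma lint_beta_scaled (u w r : ℝ) (hu : 0 < u) (hw : 0 < w) (hr : 0 < r) :
    ∫⁻ t : ℝ, (Set.Icc (0:ℝ) r).indicator
      (fun t => ENNReal.ofReal (t ^ (u - 1) * (r - t) ^ (w - 1))) t
      = ENNReal.ofReal (ProbabilityTheory.beta u w * r ^ (u + w - 1)) := by
  have hB := ProbabilityTheory.beta_pos hu hw
  have hg : Measurable ((Set.Icc (0:ℝ) r).indicator
      (fun t => ENNReal.ofReal (t ^ (u - 1) * (r - t) ^ (w - 1)))) :=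
    Measurable.indicator (by fun_prop) measurableSet_Icc
  conv_lhs => rw [← Real.smul_map_volume_mul_left hr.ne']
  rw [lintegral_smul_measure, lintegral_map hg (measurable_const_mul r)]
  have h1 : ∀ᵐ x : ℝ, (Set.Icc (0:ℝ) r).indicator
      (fun t => ENNReal.ofReal (t ^ (u - 1) * (r - t) ^ (w - 1))) (r * x)
      = ENNReal.ofReal (ProbabilityTheory.beta u w * r ^ (u + w - 2)) *
        ProbabilityTheory.betaPDF u w x := by
    have h0 : ∀ᵐ x : ℝ, x ≠ 0 := by simp [ae_iff]
    have h1 : ∀ᵐ x : ℝ, x ≠ 1 := by simp [ae_iff]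
    filter_upwards [h0, h1] with x hx0 hx1
    by_cases hx : 0 < x ∧ x < 1
    · have : r * x ∈ Set.Icc (0:ℝ) r := ⟨by nlinarith [hx.1], by nlinarith [hx.2]⟩
      rw [Set.indicator_of_mem this, ProbabilityTheory.betaPDF_of_pos_lt_one hx.1 hx.2,
        ← ENNReal.ofReal_mul (by positivity)]
      congr 1
      rw [show r - r * x = r * (1 - x) by ring, Real.mul_rpow hr.le hx.1.le,
        Real.mul_rpow hr.le (by linarith [hx.2]), show u + w - 2 = (u - 1) + (w - 1) by ring,
        Real.rpow_add hr]
      field_simp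
    · have : r * x ∉ Set.Icc (0:ℝ) r := by
        rintro ⟨h1, h2⟩
        apply hx
        have h3 : 0 ≤ x := by
          by_contra hneg
          push Not at hneg
          nlinarith
        have h4 : x ≤ 1 := by
          by_contra hneg
          push Not at hneg
          nlinarith
        exact ⟨lt_of_le_of_ne h3 (Ne.symm hx0), lt_of_le_of_ne h4 hx1⟩
      rw [Set.indicator_of_notMem this, ProbabilityTheory.betaPDF_eq, if_neg hx]
      simp
  rw [lintegral_congr_ae h1, lintegral_const_mul' _ _ ENNReal.ofReal_ne_top,
    ProbabilityTheory.lintegral_betaPDF_eq_one hu hw, mul_one, smul_eq_mul,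
    ← ENNReal.ofReal_mul (abs_nonneg r)]
  congr 1
  rw [abs_of_pos hr, show u + w - 1 = 1 + (u + w - 2) by ring, Real.rpow_add hr, Real.rpow_one]
  ring

def Sr (d : ℕ) (r : ℝ) : Set (Fin d → ℝ) := {x | (∀ i, 0 ≤ x i) ∧ ∑ i, x i ≤ r}

lemma measurableSet_Sr (d : ℕ) (r : ℝ) : MeasurableSet (Sr d r) := by
  have h1 : MeasurableSet (⋂ i, {x : Fin d → ℝ | 0 ≤ x i}) :=
    MeasurableSet.iInter fun i => measurableSet_le measurable_const (measurable_pi_apply i)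
  have h2 : MeasurableSet {x : Fin d → ℝ | ∑ i, x i ≤ r} :=
    measurableSet_le (Finset.measurable_sum _ fun i _ => measurable_pi_apply i) measurable_const
  convert h1.inter h2 using 1
  ext x; simp [Sr]

lemma Sd_eq_Sr (d : ℕ) : Sd d = Sr d 1 := by
  ext x
  constructor
  · rintro ⟨h1, h2⟩
    exact ⟨fun i => (h1 i).1, h2⟩
  · rintro ⟨h1, h2⟩
    refine ⟨fun i => ⟨h1 i, ?_⟩, h2⟩
    exact (Finset.single_le_sum (fun j _ => h1 j) (Finset.mem_univ i)).trans h2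

lemma dirichlet_lint (d : ℕ) : ∀ (u : Fin d → ℝ) (v r : ℝ), (∀ i, 0 < u i) → 0 < v → 0 < r →
    ∫⁻ x : Fin d → ℝ, (Sr d r).indicator
      (fun x => ENNReal.ofReal ((r - ∑ i, x i) ^ (v - 1) * ∏ i, (x i) ^ (u i - 1))) x
      = ENNReal.ofReal (Real.Gamma v * (∏ i, Real.Gamma (u i)) / Real.Gamma (v + ∑ i, u i)
          * r ^ (v + ∑ i, u i - 1)) := by
  induction d with
  | zero =>
    intro u v r hu hv hr
    have : Sr 0 r = Set.univ := by
      ext x; simp [Sr, hr.le]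
    rw [this]
    simp [(Real.Gamma_pos_of_pos hv).ne', volume_pi]
  | succ d ih =>
    intro u v r hu hv hr
    have hm : Measurable ((Sr (d+1) r).indicator
      (fun x => ENNReal.ofReal ((r - ∑ i, x i) ^ (v - 1) * ∏ i, (x i) ^ (u i - 1)))) :=
      Measurable.indicator (by fun_prop) (measurableSet_Sr _ _)
    have hmp := (volume_preserving_piFinSuccAbove (fun _ : Fin (d+1) => ℝ) 0).symm
    have hm2 : AEMeasurable (fun a : ℝ × (Fin d → ℝ) => (Sr (d+1) r).indicator
      (fun x => ENNReal.ofReal ((r - ∑ i, x i) ^ (v - 1) * ∏ i, (x i) ^ (u i - 1)))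
        ((MeasurableEquiv.piFinSuccAbove (fun _ : Fin (d+1) => ℝ) 0).symm a))
        ((volume : Measure ℝ).prod (volume : Measure (Fin d → ℝ))) :=
      (hm.comp hmp.measurable).aemeasurable
    rw [← hmp.lintegral_comp hm, Measure.volume_eq_prod, lintegral_prod _ hm2]
    set w := v + ∑ i : Fin d, u i.succ with hw
    have hwpos : 0 < w := add_pos_of_pos_of_nonneg hv (Finset.sum_nonneg fun i _ => (hu _).le)
    have hG := Real.Gamma_pos_of_pos hwpos
    set C := Real.Gamma v * (∏ i : Fin d, Real.Gamma (u i.succ)) / Real.Gamma w with hC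
    have hCpos : 0 < C := div_pos (mul_pos (Real.Gamma_pos_of_pos hv)
      (Finset.prod_pos fun i _ => Real.Gamma_pos_of_pos (hu _))) hG
    have key : ∀ᵐ t : ℝ, (∫⁻ y : Fin d → ℝ, (Sr (d+1) r).indicator
      (fun x => ENNReal.ofReal ((r - ∑ i, x i) ^ (v - 1) * ∏ i, (x i) ^ (u i - 1)))
        ((MeasurableEquiv.piFinSuccAbove (fun _ : Fin (d+1) => ℝ) 0).symm (t, y)))
      = ENNReal.ofReal C * (Set.Icc (0:ℝ) r).indicator
      (fun t => ENNReal.ofReal (t ^ (u 0 - 1) * (r - t) ^ (w - 1))) t := by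
      have h1 : ∀ᵐ x : ℝ, x ≠ r := by simp [ae_iff]
      filter_upwards [h1] with t htr
      by_cases ht : t ∈ Set.Icc (0:ℝ) r
      · have hrt : 0 < r - t := by
          have := lt_of_le_of_ne ht.2 htr
          linarith
        rw [Set.indicator_of_mem ht]
        have : ∀ y : Fin d → ℝ, (Sr (d+1) r).indicator
            (fun x => ENNReal.ofReal ((r - ∑ i, x i) ^ (v - 1) * ∏ i, (x i) ^ (u i - 1)))
            ((MeasurableEquiv.piFinSuccAbove (fun _ : Fin (d+1) => ℝ) 0).symm (t, y))
            = ENNReal.ofReal (t ^ (u 0 - 1)) * (Sr d (r - t)).indicator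
            (fun x => ENNReal.ofReal ((r - t - ∑ i, x i) ^ (v - 1) *
              ∏ i, (x i) ^ (u i.succ - 1))) y := by
          intro y
          have hiff : (MeasurableEquiv.piFinSuccAbove (fun _ : Fin (d+1) => ℝ) 0).symm (t, y)
              ∈ Sr (d+1) r ↔ y ∈ Sr d (r - t) := by
            simp [Sr, Fin.forall_fin_succ, Fin.sum_univ_succ, ht.1, le_sub_iff_add_le, add_comm]
          by_cases hy : y ∈ Sr d (r - t)
          · rw [Set.indicator_of_mem hy, Set.indicator_of_mem (hiff.2 hy),
              ← ENNReal.ofReal_mul (Real.rpow_nonneg ht.1 _)]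
            congr 1
            simp [Fin.sum_univ_succ, Fin.prod_univ_succ, sub_sub]
            ring
          · rw [Set.indicator_of_notMem hy, Set.indicator_of_notMem (fun h => hy (hiff.1 h)),
              mul_zero]
        simp_rw [this]
        rw [lintegral_const_mul' _ _ ENNReal.ofReal_ne_top, ih _ v (r - t) (fun i => hu _) hv hrt,
          ← hw, ← hC, ← ENNReal.ofReal_mul (Real.rpow_nonneg ht.1 _),
          ← ENNReal.ofReal_mul hCpos.le]
        congr 1
        ring
      · rw [Set.indicator_of_notMem ht, mul_zero]
        rw [lintegral_eq_zero_of_ae_eq_zero]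
        refine Filter.Eventually.of_forall fun y => ?_
        apply Set.indicator_of_notMem
        rintro ⟨h1, h2⟩
        apply ht
        have h3 := h1 0
        rw [Fin.sum_univ_succ] at h2
        have h4 := Finset.sum_nonneg (fun (i : Fin d) (_ : i ∈ Finset.univ) => h1 i.succ)
        simp at h3 h2 h4
        exact ⟨h3, by linarith⟩
    rw [lintegral_congr_ae key, lintegral_const_mul' _ _ ENNReal.ofReal_ne_top,
      lint_beta_scaled _ _ _ (hu 0) hwpos hr, ← ENNReal.ofReal_mul hCpos.le]
    congr 1
    rw [Fin.prod_univ_succ, Fin.sum_univ_succ, ProbabilityTheory.beta, hC,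
      show v + (u 0 + ∑ i : Fin d, u i.succ) = u 0 + w by rw [hw]; ring]
    field_simp


lemma measurableSet_Sd (d : ℕ) : MeasurableSet (Sd d) := by
  rw [Sd_eq_Sr]; exact measurableSet_Sr d 1

lemma volume_Sd_lt_top (d : ℕ) : volume (Sd d) < ⊤ := by
  have : Sd d ⊆ Set.Icc (0 : Fin d → ℝ) 1 := fun x hx =>
    ⟨fun i => (hx.1 i).1, fun i => (hx.1 i).2⟩
  exact (measure_mono this).trans_lt isCompact_Icc.measure_lt_top

lemma dirK_nonneg {d : ℕ} {u : Fin d → ℝ} {v : ℝ} (hu : ∀ i, 1 ≤ u i) (hv : 1 ≤ v)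
    (x : Fin d → ℝ) : 0 ≤ dirK d u v x := by
  unfold dirK
  apply Set.indicator_nonneg
  intro x hx
  have h0 : 0 < Real.Gamma (v + ∑ i, u i) := Real.Gamma_pos_of_pos
    (add_pos_of_pos_of_nonneg (by linarith) (Finset.sum_nonneg fun i _ => by linarith [hu i]))
  have h1 : 0 < Real.Gamma v := Real.Gamma_pos_of_pos (by linarith)
  have h2 : 0 < ∏ i, Real.Gamma (u i) :=
    Finset.prod_pos fun i _ => Real.Gamma_pos_of_pos (by linarith [hu i])
  have h3 : 0 ≤ ∏ i, (x i) ^ (u i - 1) :=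
    Finset.prod_nonneg fun i _ => Real.rpow_nonneg (hx.1 i).1 _
  have h4 : 0 ≤ (1 - ∑ i, x i) ^ (v - 1) := Real.rpow_nonneg (by linarith [hx.2]) _
  positivity

lemma measurable_dirK (d : ℕ) (u : Fin d → ℝ) (v : ℝ) : Measurable (dirK d u v) := by
  unfold dirK
  exact Measurable.indicator (by fun_prop) (measurableSet_Sd d)

lemma dirK_le {d : ℕ} {u : Fin d → ℝ} {v : ℝ} (hu : ∀ i, 1 ≤ u i) (hv : 1 ≤ v)
    (x : Fin d → ℝ) :
    dirK d u v x ≤ Real.Gamma (v + ∑ i, u i) / (Real.Gamma v * ∏ i, Real.Gamma (u i)) := by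
  unfold dirK
  have h0 : 0 < Real.Gamma (v + ∑ i, u i) := Real.Gamma_pos_of_pos
    (add_pos_of_pos_of_nonneg (by linarith) (Finset.sum_nonneg fun i _ => by linarith [hu i]))
  have h1 : 0 < Real.Gamma v := Real.Gamma_pos_of_pos (by linarith)
  have h2 : 0 < ∏ i, Real.Gamma (u i) :=
    Finset.prod_pos fun i _ => Real.Gamma_pos_of_pos (by linarith [hu i])
  apply Set.indicator_le' _ _ x
  · intro x hx
    have h3 : ∏ i, (x i) ^ (u i - 1) ≤ 1 :=
      Finset.prod_le_one (fun i _ => Real.rpow_nonneg (hx.1 i).1 _)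
        (fun i _ => Real.rpow_le_one (hx.1 i).1 (hx.1 i).2 (by linarith [hu i]))
    have h3' : 0 ≤ ∏ i, (x i) ^ (u i - 1) :=
      Finset.prod_nonneg fun i _ => Real.rpow_nonneg (hx.1 i).1 _
    have hs : 0 ≤ ∑ i, x i := Finset.sum_nonneg fun i _ => (hx.1 i).1
    have h4 : (1 - ∑ i, x i) ^ (v - 1) ≤ 1 :=
      Real.rpow_le_one (by linarith [hx.2]) (by linarith) (by linarith)
    have h4' : 0 ≤ (1 - ∑ i, x i) ^ (v - 1) := Real.rpow_nonneg (by linarith [hx.2]) _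
    rw [mul_assoc]
    exact mul_le_of_le_one_right (by positivity) (mul_le_one₀ h4 h3' h3)
  · intro x hx
    positivity

lemma lint_dirK {d : ℕ} {u : Fin d → ℝ} {v : ℝ} (hu : ∀ i, 1 ≤ u i) (hv : 1 ≤ v) :
    ∫⁻ x, ENNReal.ofReal (dirK d u v x) = 1 := by
  have h0 : 0 < Real.Gamma (v + ∑ i, u i) := Real.Gamma_pos_of_pos
    (add_pos_of_pos_of_nonneg (by linarith) (Finset.sum_nonneg fun i _ => by linarith [hu i]))
  have h1 : 0 < Real.Gamma v := Real.Gamma_pos_of_pos (by linarith)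
  have h2 : 0 < ∏ i, Real.Gamma (u i) :=
    Finset.prod_pos fun i _ => Real.Gamma_pos_of_pos (by linarith [hu i])
  have h := dirichlet_lint d u v 1 (fun i => by linarith [hu i]) (by linarith) one_pos
  have h3 : ∀ x, ENNReal.ofReal (dirK d u v x) =
      ENNReal.ofReal (Real.Gamma (v + ∑ i, u i) / (Real.Gamma v * ∏ i, Real.Gamma (u i))) *
      (Sr d 1).indicator
      (fun x => ENNReal.ofReal ((1 - ∑ i, x i) ^ (v - 1) * ∏ i, (x i) ^ (u i - 1))) x := by
    intro x
    unfold dirK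
    rw [Sd_eq_Sr]
    by_cases hx : x ∈ Sr d 1
    · rw [Set.indicator_of_mem hx, Set.indicator_of_mem hx, ← ENNReal.ofReal_mul (by positivity),
        mul_assoc]
    · rw [Set.indicator_of_notMem hx, Set.indicator_of_notMem hx]
      simp
  simp_rw [h3]
  rw [lintegral_const_mul' _ _ ENNReal.ofReal_ne_top, h, ← ENNReal.ofReal_mul (by positivity),
    Real.one_rpow, ← ENNReal.ofReal_one]
  congr 1
  field_simp

lemma integrable_dirK {d : ℕ} {u : Fin d → ℝ} {v : ℝ} (hu : ∀ i, 1 ≤ u i) (hv : 1 ≤ v) :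
    Integrable (dirK d u v) := by
  refine ⟨(measurable_dirK d u v).aestronglyMeasurable, ?_⟩
  rw [hasFiniteIntegral_iff_ofReal (Eventually.of_forall (dirK_nonneg hu hv)), lint_dirK hu hv]
  simp

lemma integral_dirK {d : ℕ} {u : Fin d → ℝ} {v : ℝ} (hu : ∀ i, 1 ≤ u i) (hv : 1 ≤ v) :
    ∫ x, dirK d u v x = 1 := by
  rw [integral_eq_lintegral_of_nonneg_ae (Eventually.of_forall (dirK_nonneg hu hv))
    (measurable_dirK d u v).aestronglyMeasurable, lint_dirK hu hv]
  simp

lemma dirK_zero_off {d : ℕ} {u : Fin d → ℝ} {v : ℝ} {x : Fin d → ℝ} (hx : x ∉ Sd d) :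
    dirK d u v x = 0 := Set.indicator_of_notMem hx _

lemma integrable_mul_dirK {d : ℕ} {u : Fin d → ℝ} {v : ℝ} (hu : ∀ i, 1 ≤ u i) (hv : 1 ≤ v)
    (g : (Fin d → ℝ) → ℝ) (hg : Measurable g) (C : ℝ) (hC : ∀ x ∈ Sd d, |g x| ≤ C) :
    Integrable (fun x => g x * dirK d u v x) := by
  refine Integrable.mono' ((integrable_dirK hu hv).const_mul C)
    (hg.mul (measurable_dirK d u v)).aestronglyMeasurable (Eventually.of_forall fun x => ?_)
  by_cases hx : x ∈ Sd d
  · rw [Real.norm_eq_abs, abs_mul, abs_of_nonneg (dirK_nonneg hu hv x)]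
    exact mul_le_mul_of_nonneg_right (hC x hx) (dirK_nonneg hu hv x)
  · simp [dirK_zero_off hx]

lemma dirK_shift {d : ℕ} {u : Fin d → ℝ} {v : ℝ} (hu : ∀ i, 1 ≤ u i) (hv : 1 ≤ v)
    (i : Fin d) (x : Fin d → ℝ) :
    x i * dirK d u v x = u i / (v + ∑ j, u j) * dirK d (u + Pi.single i 1) v x := by
  unfold dirK
  by_cases hx : x ∈ Sd d
  · rw [Set.indicator_of_mem hx, Set.indicator_of_mem hx]
    have hpos : 0 < v + ∑ j, u j :=
      (add_pos_of_pos_of_nonneg (by linarith) (Finset.sum_nonneg fun i _ => by linarith [hu i]))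
    have h0 : 0 < Real.Gamma (v + ∑ i, u i) := Real.Gamma_pos_of_pos hpos
    have h1 : 0 < Real.Gamma v := Real.Gamma_pos_of_pos (by linarith)
    have h2 : 0 < ∏ i, Real.Gamma (u i) :=
      Finset.prod_pos fun i _ => Real.Gamma_pos_of_pos (by linarith [hu i])
    have e1 : ∏ j, x j ^ ((u + Pi.single i 1 : Fin d → ℝ) j - 1)
        = (∏ j, x j ^ (u j - 1)) * x i := by
      have : ∀ j, x j ^ ((u + Pi.single i 1 : Fin d → ℝ) j - 1)
          = x j ^ (u j - 1) * (if j = i then x j else 1) := by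
        intro j
        by_cases hj : j = i
        · subst hj
          simp only [Pi.add_apply, Pi.single_eq_same, if_true]
          rw [show u j + 1 - 1 = (u j - 1) + 1 by ring,
            Real.rpow_add_of_nonneg (hx.1 j).1 (by linarith [hu j]) zero_le_one, Real.rpow_one]
        · simp [hj]
      simp_rw [this]
      rw [Finset.prod_mul_distrib, Finset.prod_ite_eq']
      simp
    have e2 : ∏ j, Real.Gamma ((u + Pi.single i 1 : Fin d → ℝ) j)
        = (∏ j, Real.Gamma (u j)) * u i := by
      have : ∀ j, Real.Gamma ((u + Pi.single i 1 : Fin d → ℝ) j)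
          = Real.Gamma (u j) * (if j = i then u j else 1) := by
        intro j
        by_cases hj : j = i
        · subst hj
          simp only [Pi.add_apply, Pi.single_eq_same, if_true]
          rw [Real.Gamma_add_one (by linarith [hu j])]
          ring
        · simp [hj]
      simp_rw [this]
      rw [Finset.prod_mul_distrib, Finset.prod_ite_eq']
      simp
    have e3 : v + ∑ j, (u + Pi.single i 1 : Fin d → ℝ) j = (v + ∑ j, u j) + 1 := by
      simp [Finset.sum_add_distrib, add_assoc]
    rw [e1, e2, e3, Real.Gamma_add_one hpos.ne']
    have hui : u i ≠ 0 := by linarith [hu i]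
    field_simp
  · rw [Set.indicator_of_notMem hx, Set.indicator_of_notMem hx]
    simp

lemma dirK_moment {d : ℕ} {v : ℝ} (hv : 1 ≤ v) (i : Fin d) (k : ℕ) :
    ∀ (u : Fin d → ℝ), (∀ i, 1 ≤ u i) →
    ∫ x, x i ^ k * dirK d u v x
      = ∏ j ∈ Finset.range k, (u i + j) / (v + ∑ l, u l + j) := by
  induction k with
  | zero => intro u hu; simp [integral_dirK hu hv]
  | succ k ih =>
    intro u hu
    have hu' : ∀ j, 1 ≤ (u + Pi.single i 1 : Fin d → ℝ) j := by
      intro j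
      have := hu j
      by_cases hj : j = i
      · subst hj; simp; linarith
      · simp [hj, this]
    have : ∀ x : Fin d → ℝ, x i ^ (k + 1) * dirK d u v x
        = u i / (v + ∑ j, u j) * (x i ^ k * dirK d (u + Pi.single i 1) v x) := by
      intro x
      rw [pow_succ, mul_assoc, dirK_shift hu hv]
      ring
    simp_rw [this]
    rw [integral_const_mul, ih _ hu', Finset.prod_range_succ', mul_comm]
    congr 1
    · apply Finset.prod_congr rfl
      intro j _
      simp [Finset.sum_add_distrib]
      congr 1 <;> ring
    · simp


lemma kb_u {d : ℕ} {b : ℝ} (hb : 0 < b) {s : Fin d → ℝ} (hs : s ∈ Sd d) :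
    ∀ i, 1 ≤ (fun i => s i / b + 1) i := by
  intro i
  have := div_nonneg (hs.1 i).1 hb.le
  simp only
  linarith

lemma kb_v {d : ℕ} {b : ℝ} (hb : 0 < b) {s : Fin d → ℝ} (hs : s ∈ Sd d) :
    1 ≤ (1 - ∑ i, s i) / b + 1 := by
  have := div_nonneg (sub_nonneg.2 hs.2) hb.le
  linarith

lemma kb_moment {d : ℕ} {b : ℝ} (hb : 0 < b) {s : Fin d → ℝ} (hs : s ∈ Sd d) (i : Fin d)
    (k : ℕ) : ∫ x, x i ^ k * dirKb d b s x
      = ∏ j ∈ Finset.range k, (s i + (1 + j) * b) / (1 + ((d:ℝ) + 1 + j) * b) := by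
  unfold dirKb
  rw [dirK_moment (kb_v hb hs) i k _ (kb_u hb hs)]
  apply Finset.prod_congr rfl
  intro j _
  have : (1 - ∑ i, s i) / b + 1 + ∑ l, (s l / b + 1) + j = (1 + ((d:ℝ) + 1 + j) * b) / b := by
    rw [Finset.sum_add_distrib, ← Finset.sum_div]
    simp
    field_simp
    ring
  rw [this]
  have h1 : 0 < 1 + ((d:ℝ) + 1 + j) * b := by positivity
  field_simp
  ring

lemma kb_integrable {d : ℕ} {b : ℝ} (hb : 0 < b) {s : Fin d → ℝ} (hs : s ∈ Sd d)
    (g : (Fin d → ℝ) → ℝ) (hg : Measurable g) (C : ℝ) (hC : ∀ x ∈ Sd d, |g x| ≤ C) :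
    Integrable (fun x => g x * dirKb d b s x) :=
  integrable_mul_dirK (kb_u hb hs) (kb_v hb hs) g hg C hC

lemma kb_integral {d : ℕ} {b : ℝ} (hb : 0 < b) {s : Fin d → ℝ} (hs : s ∈ Sd d) :
    ∫ x, dirKb d b s x = 1 := integral_dirK (kb_u hb hs) (kb_v hb hs)

lemma kb_nonneg {d : ℕ} {b : ℝ} (hb : 0 < b) {s : Fin d → ℝ} (hs : s ∈ Sd d) (x : Fin d → ℝ) :
    0 ≤ dirKb d b s x := dirK_nonneg (kb_u hb hs) (kb_v hb hs) x

lemma kb_measurable {d : ℕ} {b : ℝ} {s : Fin d → ℝ} : Measurable (dirKb d b s) :=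
  measurable_dirK _ _ _

lemma kb_central {d : ℕ} {b : ℝ} (hb : 0 < b) {s : Fin d → ℝ} (hs : s ∈ Sd d) (i : Fin d)
    (a : ℝ) (k : ℕ) : ∫ x, (x i - a) ^ k * dirKb d b s x
      = ∑ m ∈ Finset.range (k + 1), (-a) ^ (k - m) * (k.choose m) *
        ∏ j ∈ Finset.range m, (s i + (1 + j) * b) / (1 + ((d:ℝ) + 1 + j) * b) := by
  have : ∀ x : Fin d → ℝ, (x i - a) ^ k * dirKb d b s x
      = ∑ m ∈ Finset.range (k + 1), (-a) ^ (k - m) * (k.choose m) *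
        (x i ^ m * dirKb d b s x) := by
    intro x
    rw [sub_eq_add_neg, add_pow, Finset.sum_mul]
    apply Finset.sum_congr rfl
    intro m _
    ring
  simp_rw [this]
  rw [integral_finsetSum]
  · apply Finset.sum_congr rfl
    intro m _
    rw [integral_const_mul, kb_moment hb hs]
  · intro m _
    apply Integrable.const_mul
    apply kb_integrable hb hs (fun x => x i ^ m) (by fun_prop) 1
    intro x hx
    rw [abs_of_nonneg (pow_nonneg (hx.1 i).1 m)]
    exact pow_le_one₀ (hx.1 i).1 (hx.1 i).2

lemma kb_second {d : ℕ} {b : ℝ} (hb : 0 < b) {s : Fin d → ℝ} (hs : s ∈ Sd d) (i : Fin d) :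
    ∫ x, (x i - s i) ^ 2 * dirKb d b s x
      = (b * (s i * (1 - s i)) + b ^ 2 * (2 - 2 * ((d:ℝ) + 2) * s i
          + ((d:ℝ) + 1) * ((d:ℝ) + 2) * s i ^ 2))
        / ((1 + ((d:ℝ) + 1) * b) * (1 + ((d:ℝ) + 2) * b)) := by
  rw [kb_central hb hs]
  have h0 : 0 < 1 + ((d:ℝ) + 1) * b := by positivity
  have h1 : 0 < 1 + ((d:ℝ) + 2) * b := by positivity
  have h1' : 0 < 1 + ((d:ℝ) + 1 + 1) * b := by positivity
  simp [Finset.sum_range_succ, Finset.prod_range_succ]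
  rw [show (d:ℝ) + 1 + 1 = d + 2 by ring]
  field_simp
  ring

lemma kb_second_lower {d : ℕ} {b : ℝ} (hb : 0 < b) (hb1 : b < 1) {s : Fin d → ℝ} (hs : s ∈ Sd d)
    (i : Fin d) :
    b * (s i * (1 - s i)) / ((d:ℝ) + 3) ^ 2 ≤ ∫ x, (x i - s i) ^ 2 * dirKb d b s x := by
  rw [kb_second hb hs]
  have hd : (0:ℝ) ≤ d := Nat.cast_nonneg d
  have h0 : 0 < 1 + ((d:ℝ) + 1) * b := by positivity
  have h1 : 0 < 1 + ((d:ℝ) + 2) * b := by positivity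
  have h2 : 0 ≤ 2 - 2 * ((d:ℝ) + 2) * s i + ((d:ℝ) + 1) * ((d:ℝ) + 2) * s i ^ 2 := by
    have e : 2 * (2 - 2 * ((d:ℝ) + 2) * s i + ((d:ℝ) + 1) * ((d:ℝ) + 2) * s i ^ 2)
      = (2 - ((d:ℝ) + 2) * s i) ^ 2 + ((d:ℝ) + 2) * d * s i ^ 2 := by ring
    have : 0 ≤ (2 - ((d:ℝ) + 2) * s i) ^ 2 + ((d:ℝ) + 2) * d * s i ^ 2 := by positivity
    linarith
  have h3 := (hs.1 i).1
  have h4 : 0 ≤ 1 - s i := by linarith [(hs.1 i).2]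
  apply div_le_div₀
  · positivity
  · have := mul_nonneg (sq_nonneg b) h2
    linarith
  · positivity
  · have a1 : 1 + ((d:ℝ) + 1) * b ≤ d + 3 := by nlinarith
    have a2 : 1 + ((d:ℝ) + 2) * b ≤ d + 3 := by nlinarith
    rw [pow_two]
    exact mul_le_mul a1 a2 h1.le (by positivity)

lemma kb_second_upper {d : ℕ} {b : ℝ} (hb : 0 < b) (hb1 : b < 1) {s : Fin d → ℝ} (hs : s ∈ Sd d)
    (i : Fin d) :
    ∫ x, (x i - s i) ^ 2 * dirKb d b s x ≤ ((d:ℝ) + 3) ^ 2 * (b * (s i + b)) := by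
  rw [kb_second hb hs]
  have hd : (0:ℝ) ≤ d := Nat.cast_nonneg d
  have h0 : 1 ≤ 1 + ((d:ℝ) + 1) * b := by nlinarith
  have h1 : 1 ≤ 1 + ((d:ℝ) + 2) * b := by nlinarith
  have h3 := (hs.1 i).1
  have h4 := (hs.1 i).2
  have h5 : 1 ≤ (1 + ((d:ℝ) + 1) * b) * (1 + ((d:ℝ) + 2) * b) := one_le_mul_of_one_le_of_one_le h0 h1
  rw [div_le_iff₀ (by linarith)]
  have hR : 0 ≤ ((d:ℝ) + 3) ^ 2 * (b * (s i + b)) := by positivity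
  refine le_trans ?_ (le_mul_of_one_le_right hR h5)
  have e1 : b * (s i * (1 - s i)) ≤ b * s i := by
    apply mul_le_mul_of_nonneg_left _ hb.le
    nlinarith
  have e2 : s i ^ 2 * b ^ 2 ≤ b * s i := by
    have : s i * b ≤ 1 := by nlinarith
    nlinarith [mul_nonneg h3 hb.le]
  have e3 : ((d:ℝ) + 1) * ((d:ℝ) + 2) * (s i ^ 2 * b ^ 2) ≤ ((d:ℝ) + 1) * ((d:ℝ) + 2) * (b * s i) :=
    mul_le_mul_of_nonneg_left e2 (by positivity)
  have e4 : 0 ≤ ((d:ℝ) + 2) * s i * b ^ 2 := by positivity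
  have e5 : 0 ≤ (d:ℝ) * (b * s i) := by positivity
  have e6 : 0 ≤ (d:ℝ) * b ^ 2 := by positivity
  have e7 : 0 ≤ (d:ℝ) ^ 2 * b ^ 2 := by positivity
  have e8 : 0 ≤ b * s i := by positivity
  nlinarith

lemma kb_fourth (d : ℕ) : ∃ C : ℝ, 0 < C ∧ ∀ (b : ℝ) (s : Fin d → ℝ) (i : Fin d), 0 < b → b < 1 →
    s ∈ Sd d → ∫ x, (x i - s i) ^ 4 * dirKb d b s x ≤ C * b ^ 2 := by
  let Q : ℝ → ℝ → ℝ → ℝ := fun N s b =>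
    (24)*b^2 + (26)*s^1*b^1 + (-72)*s^1*b^2 + (-24)*s^1*b^2*N^1 + (3)*s^2 + (-72)*s^2*b^1 + (-20)*s^2*b^1*N^1 + (72)*s^2*b^2 + (60)*s^2*b^2*N^1 + (12)*s^2*b^2*N^2 + (-6)*s^3 + (64)*s^3*b^1 + (42)*s^3*b^1*N^1 + (6)*s^3*b^1*N^2 + (-24)*s^3*b^2 + (-44)*s^3*b^2*N^1 + (-24)*s^3*b^2*N^2 + (-4)*s^3*b^2*N^3 + (3)*s^4 + (-18)*s^4*b^1 + (-22)*s^4*b^1*N^1 + (-6)*s^4*b^1*N^2 + (6)*s^4*b^2*N^1 + (11)*s^4*b^2*N^2 + (6)*s^4*b^2*N^3 + s^4*b^2*N^4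
  have hcont : Continuous (fun z : ℝ × ℝ => Q ((d:ℝ) + 1) z.1 z.2) := by
    simp only [Q]; fun_prop
  obtain ⟨C, hC⟩ := (isCompact_Icc (a := ((0:ℝ), (0:ℝ))) (b := ((1:ℝ), (1:ℝ)))).exists_bound_of_continuousOn
    hcont.continuousOn
  refine ⟨|C| + 1, by positivity, fun b s i hb hb1 hs => ?_⟩
  have hd : (0:ℝ) ≤ d := Nat.cast_nonneg d
  have h3 := (hs.1 i).1
  have h4 := (hs.1 i).2
  have hQ : Q ((d:ℝ) + 1) (s i) b ≤ |C| + 1 := by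
    have := hC (s i, b) ⟨⟨h3, hb.le⟩, ⟨h4, hb1.le⟩⟩
    simp only [Real.norm_eq_abs] at this
    linarith [le_abs_self (Q ((d:ℝ) + 1) (s i) b), le_abs_self C]
  have h0 : 1 ≤ 1 + ((d:ℝ) + 1) * b := by nlinarith
  have h1 : 1 ≤ 1 + ((d:ℝ) + 1 + 1) * b := by nlinarith
  have h2 : 1 ≤ 1 + ((d:ℝ) + 1 + 2) * b := by nlinarith
  have h2' : 1 ≤ 1 + ((d:ℝ) + 1 + 3) * b := by nlinarith
  have hD : 1 ≤ (1 + ((d:ℝ) + 1) * b) * (1 + ((d:ℝ) + 1 + 1) * b) * (1 + ((d:ℝ) + 1 + 2) * b)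
      * (1 + ((d:ℝ) + 1 + 3) * b) :=
    one_le_mul_of_one_le_of_one_le (one_le_mul_of_one_le_of_one_le
      (one_le_mul_of_one_le_of_one_le h0 h1) h2) h2'
  have e : ∫ x, (x i - s i) ^ 4 * dirKb d b s x = b ^ 2 * Q ((d:ℝ) + 1) (s i) b /
      ((1 + ((d:ℝ) + 1) * b) * (1 + ((d:ℝ) + 1 + 1) * b) * (1 + ((d:ℝ) + 1 + 2) * b)
      * (1 + ((d:ℝ) + 1 + 3) * b)) := by
    rw [kb_central hb hs]
    simp only [Q]
    generalize (d:ℝ) + 1 = N at *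
    have z0 : 1 + N * b ≠ 0 := by linarith
    have z1 : 1 + (N + 1) * b ≠ 0 := by linarith
    have z2 : 1 + (N + 2) * b ≠ 0 := by linarith
    have z3 : 1 + (N + 3) * b ≠ 0 := by linarith
    simp only [Finset.sum_range_succ, Finset.prod_range_succ, Finset.range_zero, Finset.sum_empty,
      Finset.prod_empty]
    norm_num [Nat.choose]
    obtain ⟨D0, hD0⟩ : ∃ y, y = 1 + N * b := ⟨_, rfl⟩
    obtain ⟨D1, hD1⟩ : ∃ y, y = 1 + (N + 1) * b := ⟨_, rfl⟩
    obtain ⟨D2, hD2⟩ : ∃ y, y = 1 + (N + 2) * b := ⟨_, rfl⟩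
    obtain ⟨D3, hD3⟩ : ∃ y, y = 1 + (N + 3) * b := ⟨_, rfl⟩
    rw [← hD0] at z0
    rw [← hD1] at z1
    rw [← hD2] at z2
    rw [← hD3] at z3
    rw [← hD0, ← hD1, ← hD2, ← hD3]
    field_simp
    subst hD0 hD1 hD2 hD3
    ring
  rw [e, div_le_iff₀ (by linarith)]
  have : b ^ 2 * Q ((d:ℝ) + 1) (s i) b ≤ (|C| + 1) * b ^ 2 := by
    rw [mul_comm]; exact mul_le_mul_of_nonneg_right hQ (sq_nonneg b)
  exact this.trans (le_mul_of_one_le_right (by positivity) hD)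


lemma continuous_Gamma_max : Continuous (fun y : ℝ => Real.Gamma (max 1 y)) := by
  rw [continuous_iff_continuousAt]
  intro y
  have h : 0 < max 1 y := lt_max_of_lt_left one_pos
  have h1 : ContinuousAt Real.Gamma (max 1 y) := by
    apply (Real.differentiableAt_Gamma _).continuousAt
    intro m hm
    have : (0:ℝ) ≤ m := Nat.cast_nonneg m
    linarith
  exact ContinuousAt.comp (f := fun y : ℝ => max 1 y) (g := Real.Gamma) h1
    (by fun_prop)

lemma kb_joint_measurable (d : ℕ) {b : ℝ} (hb : 0 < b) :
    ∃ F : (Fin d → ℝ) × (Fin d → ℝ) → ℝ, Measurable F ∧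
      ∀ s ∈ Sd d, ∀ x, dirKb d b s x = F (s, x) := by
  have hG : Measurable (fun y : ℝ => Real.Gamma (max 1 y)) := continuous_Gamma_max.measurable
  let Gm : ℝ → ℝ := fun y => Real.Gamma (max 1 y)
  have hGm : Measurable Gm := hG
  have hGe : ∀ y, 1 ≤ y → Gm y = Real.Gamma y := by
    intro y hy
    simp only [Gm]
    rw [max_eq_right hy]
  refine ⟨(Prod.snd ⁻¹' (Sd d)).indicator (fun z =>
    Gm ((1 - ∑ i, z.1 i) / b + 1 + ∑ i, (z.1 i / b + 1)) /
      (Gm ((1 - ∑ i, z.1 i) / b + 1) * ∏ i, Gm (z.1 i / b + 1)) *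
      (1 - ∑ i, z.2 i) ^ ((1 - ∑ i, z.1 i) / b + 1 - 1) *
      ∏ i, (z.2 i) ^ (z.1 i / b + 1 - 1)), ?_, ?_⟩
  · apply Measurable.indicator _ (measurable_snd (measurableSet_Sd d))
    have h1 : ∀ i, Measurable (fun z : (Fin d → ℝ) × (Fin d → ℝ) => z.1 i) :=
      fun i => (measurable_pi_apply i).comp measurable_fst
    have h2 : ∀ i, Measurable (fun z : (Fin d → ℝ) × (Fin d → ℝ) => z.2 i) :=
      fun i => (measurable_pi_apply i).comp measurable_snd
    have h3 : Measurable (fun z : (Fin d → ℝ) × (Fin d → ℝ) => ∑ i, z.1 i) :=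
      Finset.measurable_sum _ fun i _ => h1 i
    have h4 : Measurable (fun z : (Fin d → ℝ) × (Fin d → ℝ) => ∑ i, z.2 i) :=
      Finset.measurable_sum _ fun i _ => h2 i
    have h5 : Measurable (fun z : (Fin d → ℝ) × (Fin d → ℝ) => ∑ i, (z.1 i / b + 1)) :=
      Finset.measurable_sum _ fun i _ => ((h1 i).div_const b).add_const 1
    have h6 : Measurable (fun z : (Fin d → ℝ) × (Fin d → ℝ) => ∏ i, Gm (z.1 i / b + 1)) :=
      Finset.measurable_prod _ fun i _ => hGm.comp (((h1 i).div_const b).add_const 1)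
    have h7 : Measurable (fun z : (Fin d → ℝ) × (Fin d → ℝ) =>
        ∏ i, (z.2 i) ^ (z.1 i / b + 1 - 1)) :=
      Finset.measurable_prod _ fun i _ =>
        (h2 i).pow ((((h1 i).div_const b).add_const 1).sub_const 1)
    have h8 : Measurable (fun z : (Fin d → ℝ) × (Fin d → ℝ) => (1 - ∑ i, z.1 i) / b + 1) :=
      ((h3.const_sub 1).div_const b).add_const 1
    exact (((hGm.comp (h8.add h5)).div ((hGm.comp h8).mul h6)).mul
      ((h4.const_sub 1).pow (h8.sub_const 1))).mul h7
  · intro s hs x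
    have hu := kb_u hb hs
    have hv := kb_v hb hs
    unfold dirKb dirK
    by_cases hx : x ∈ Sd d
    · rw [Set.indicator_of_mem hx, Set.indicator_of_mem (show (s, x) ∈ Prod.snd ⁻¹' (Sd d) from hx)]
      have e1 : ∏ i, Gm (s i / b + 1) = ∏ i, Real.Gamma (s i / b + 1) :=
        Finset.prod_congr rfl fun i _ => hGe _ (hu i)
      have h0 : 0 ≤ ∑ i, (s i / b + 1) := Finset.sum_nonneg fun i _ => by
        have := hu i; simp only at this; linarith
      simp only
      rw [e1, hGe _ hv, hGe _ (by linarith)]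
    · rw [Set.indicator_of_notMem hx,
        Set.indicator_of_notMem (show (s, x) ∉ Prod.snd ⁻¹' (Sd d) from hx)]

lemma kb_bound (d : ℕ) {b : ℝ} (hb : 0 < b) :
    ∃ C : ℝ, 0 ≤ C ∧ ∀ s ∈ Sd d, ∀ x, dirKb d b s x ≤ C := by
  obtain ⟨y0, hy0, hmin⟩ := (isCompact_Icc (a := (1:ℝ)) (b := 1 / b + 1)).exists_isMinOn
    (f := fun y : ℝ => Real.Gamma (max 1 y)) ⟨1, by constructor <;> [rfl; (have := one_div_pos.2 hb; linarith)]⟩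
    continuous_Gamma_max.continuousOn
  set c := Real.Gamma (max 1 y0) with hc
  have hcpos : 0 < c := Real.Gamma_pos_of_pos (lt_max_of_lt_left one_pos)
  have hlow : ∀ y, 1 ≤ y → y ≤ 1 / b + 1 → c ≤ Real.Gamma y := by
    intro y h1 h2
    have := hmin (show y ∈ Set.Icc (1:ℝ) (1 / b + 1) from ⟨h1, h2⟩)
    simpa [max_eq_right h1] using this
  have hpos : 0 < Real.Gamma (1 / b + d + 1) := Real.Gamma_pos_of_pos (by positivity)
  refine ⟨Real.Gamma (1 / b + d + 1) / (c * c ^ d), by positivity, fun s hs x => ?_⟩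
  have hu := kb_u hb hs
  have hv := kb_v hb hs
  refine (dirK_le hu hv x).trans ?_
  have e : (1 - ∑ i, s i) / b + 1 + ∑ l, (s l / b + 1) = 1 / b + d + 1 := by
    rw [Finset.sum_add_distrib, ← Finset.sum_div]
    simp
    field_simp
    ring
  rw [e]
  have hs0 : 0 ≤ ∑ i, s i := Finset.sum_nonneg fun i _ => (hs.1 i).1
  apply div_le_div_of_nonneg_left hpos.le (by positivity)
  apply mul_le_mul
  · apply hlow _ hv
    have : (1 - ∑ i, s i) / b ≤ 1 / b := div_le_div_of_nonneg_right (by linarith) hb.le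
    linarith
  · have : c ^ d = ∏ i : Fin d, c := by simp
    rw [this]
    apply Finset.prod_le_prod (fun _ _ => hcpos.le)
    intro i _
    apply hlow _ (hu i)
    have : s i / b ≤ 1 / b := div_le_div_of_nonneg_right (hs.1 i).2 hb.le
    linarith
  · positivity
  · exact (Real.Gamma_pos_of_pos (by linarith)).le

structure GoodF (d : ℕ) (f : (Fin d → ℝ) → ℝ) (M : ℝ) : Prop where
  meas : Measurable f
  nonneg : ∀ x, 0 ≤ f x
  le : ∀ x, f x ≤ M
  int : ∫ x, f x = 1

lemma GoodF.integrable {d : ℕ} {f : (Fin d → ℝ) → ℝ} {M : ℝ} (h : GoodF d f M) :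
    Integrable f := by
  by_contra hn
  have := h.int
  rw [integral_undef hn] at this
  norm_num at this

def nuF {d : ℕ} (f : (Fin d → ℝ) → ℝ) : Measure (Fin d → ℝ) :=
  volume.withDensity (fun x => ENNReal.ofReal (f x))

lemma GoodF.prob {d : ℕ} {f : (Fin d → ℝ) → ℝ} {M : ℝ} (h : GoodF d f M) :
    IsProbabilityMeasure (nuF f) := by
  constructor
  rw [nuF, withDensity_apply _ MeasurableSet.univ, Measure.restrict_univ,
    ← ofReal_integral_eq_lintegral_ofReal h.integrable (Eventually.of_forall h.nonneg), h.int]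
  simp

lemma GoodF.integral_nu {d : ℕ} {f : (Fin d → ℝ) → ℝ} {M : ℝ} (h : GoodF d f M)
    (g : (Fin d → ℝ) → ℝ) : ∫ x, g x ∂(nuF f) = ∫ x, g x * f x := by
  rw [nuF, integral_withDensity_eq_integral_toReal_smul h.meas.ennreal_ofReal
    (Eventually.of_forall fun x => ENNReal.ofReal_lt_top)]
  apply integral_congr_ae
  refine Eventually.of_forall fun x => ?_
  simp only [ENNReal.toReal_ofReal (h.nonneg x), smul_eq_mul, mul_comm]

lemma GoodF.pi_eq {d : ℕ} {f : (Fin d → ℝ) → ℝ} {M : ℝ} (h : GoodF d f M) (n : ℕ) :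
    Measure.pi (fun _ : Fin n => nuF f)
      = volume.withDensity (fun ω : Fin n → Fin d → ℝ => ENNReal.ofReal (∏ i, f (ω i))) := by
  have := h.prob
  apply Measure.pi_eq
  intro S hS
  have hSm : MeasurableSet (Set.univ.pi S) := MeasurableSet.univ_pi hS
  rw [withDensity_apply _ hSm, ← lintegral_indicator hSm]
  have e : ∀ ω : Fin n → Fin d → ℝ, (Set.univ.pi S).indicator
      (fun ω : Fin n → Fin d → ℝ => ENNReal.ofReal (∏ i, f (ω i))) ω
      = ENNReal.ofReal (∏ i, (S i).indicator f (ω i)) := by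
    intro ω
    by_cases hω : ω ∈ Set.univ.pi S
    · rw [Set.indicator_of_mem hω]
      congr 1
      apply Finset.prod_congr rfl
      intro i _
      rw [Set.indicator_of_mem (hω i (Set.mem_univ i))]
    · rw [Set.indicator_of_notMem hω]
      simp only [Set.mem_pi, Set.mem_univ, true_imp_iff, not_forall] at hω
      obtain ⟨i, hi⟩ := hω
      rw [Finset.prod_eq_zero (Finset.mem_univ i) (Set.indicator_of_notMem hi f)]
      simp
  simp_rw [e]
  have hInteg : ∀ i, Integrable ((S i).indicator f) volume := fun i => h.integrable.indicator (hS i)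
  have hnn : ∀ i x, 0 ≤ (S i).indicator f x := fun i x => Set.indicator_nonneg (fun x _ => h.nonneg x) x
  have hI : Integrable (fun ω : Fin n → Fin d → ℝ => ∏ i, (S i).indicator f (ω i)) volume :=
    Integrable.fintype_prod hInteg
  rw [← ofReal_integral_eq_lintegral_ofReal hI
    (Eventually.of_forall fun ω => Finset.prod_nonneg fun i _ => hnn i _),
    integral_fintype_prod_volume_eq_prod (fun i => (S i).indicator f),
    ENNReal.ofReal_prod_of_nonneg (fun i _ => integral_nonneg (hnn i))]
  apply Finset.prod_congr rfl
  intro i _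
  rw [ofReal_integral_eq_lintegral_ofReal (hInteg i) (Eventually.of_forall (hnn i)), nuF,
    withDensity_apply _ (hS i), ← lintegral_indicator (hS i)]
  apply lintegral_congr
  intro x
  by_cases hx : x ∈ S i
  · simp [hx]
  · simp [hx]

lemma GoodF.integral_pi {d : ℕ} {f : (Fin d → ℝ) → ℝ} {M : ℝ} (h : GoodF d f M) (n : ℕ)
    (g : (Fin n → Fin d → ℝ) → ℝ) :
    ∫ ω, (∏ i, f (ω i)) * g ω = ∫ ω, g ω ∂(Measure.pi (fun _ : Fin n => nuF f)) := by
  have hm : Measurable (fun ω : Fin n → Fin d → ℝ => ENNReal.ofReal (∏ i, f (ω i))) :=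
    (Finset.measurable_prod _ fun i _ => h.meas.comp (measurable_pi_apply i)).ennreal_ofReal
  rw [h.pi_eq, integral_withDensity_eq_integral_toReal_smul hm
    (Eventually.of_forall fun x => ENNReal.ofReal_lt_top)]
  apply integral_congr_ae
  refine Eventually.of_forall fun x => ?_
  simp only [smul_eq_mul]
  rw [ENNReal.toReal_ofReal (Finset.prod_nonneg fun i _ => h.nonneg _)]

lemma jensen1 {Ω : Type*} [MeasurableSpace Ω] (P : Measure Ω) [IsProbabilityMeasure P] (Z : Ω → ℝ)
    (hZ : Measurable Z) (C : ℝ) (hC : ∀ ω, |Z ω| ≤ C) (q : ℝ) (hq : 1 ≤ q) :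
    |∫ ω, Z ω ∂P| ^ q ≤ ∫ ω, |Z ω| ^ q ∂P := by
  have h1 : |∫ ω, Z ω ∂P| ≤ ∫ ω, |Z ω| ∂P := abs_integral_le_integral_abs
  refine (Real.rpow_le_rpow (abs_nonneg _) h1 (by linarith)).trans ?_
  refine ConvexOn.map_integral_le (convexOn_rpow hq) (Real.continuous_rpow_const (by linarith)).continuousOn
    isClosed_Ici (Eventually.of_forall fun ω => Set.mem_Ici.2 (abs_nonneg (Z ω))) ?_ ?_
  · refine Integrable.of_bound (by fun_prop) C (Eventually.of_forall fun ω => ?_)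
    simpa using hC ω
  · refine Integrable.of_bound ?_ (C ^ q) (Eventually.of_forall fun ω => ?_)
    · exact (Measurable.pow_const (by fun_prop) q).aestronglyMeasurable
    · simp only [Function.comp]
      rw [Real.norm_eq_abs, abs_of_nonneg (Real.rpow_nonneg (abs_nonneg _) _)]
      exact Real.rpow_le_rpow (abs_nonneg _) (hC ω) (by linarith)

lemma risk_repr {d n : ℕ} {f : (Fin d → ℝ) → ℝ} {M : ℝ} (h : GoodF d f M) (hn : 1 ≤ n)
    {b p : ℝ} (hb : 0 < b) (hp : 2 ≤ p) :
    ∃ R : (Fin d → ℝ) → ℝ, IntegrableOn R (Sd d) ∧ lpRiskPow d n b p f = ∫ s in Sd d, R s ∧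
      ∀ s ∈ Sd d, 0 ≤ R s ∧ |(∫ x, dirKb d b s x * f x) - f s| ^ p ≤ R s ∧
        (0 ≤ (n:ℝ)⁻¹ * ((∫ x, (dirKb d b s x) ^ 2 * f x) - (∫ x, dirKb d b s x * f x) ^ 2) ∧
        ((n:ℝ)⁻¹ * ((∫ x, (dirKb d b s x) ^ 2 * f x) - (∫ x, dirKb d b s x * f x) ^ 2)) ^ (p / 2)
          ≤ R s) := by
  have hprob := h.prob
  obtain ⟨C, hC0, hC⟩ := kb_bound d hb
  obtain ⟨F, hFm, hF⟩ := kb_joint_measurable d hb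
  have hn0 : (0:ℝ) < n := by exact_mod_cast hn
  have hM0 : 0 ≤ M := (h.nonneg 0).trans (h.le 0)
  set P := Measure.pi (fun _ : Fin n => nuF f) with hP
  have hfh : ∀ s ∈ Sd d, ∀ ω, |fhat d n b ω s - f s| ≤ C + M := by
    intro s hs ω
    have h1 : 0 ≤ fhat d n b ω s :=
      mul_nonneg (by positivity) (Finset.sum_nonneg fun i _ => kb_nonneg hb hs _)
    have h2 : fhat d n b ω s ≤ C := by
      unfold fhat
      have : ∑ i, dirKb d b s (ω i) ≤ ∑ i : Fin n, C := Finset.sum_le_sum fun i _ => hC s hs _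
      simp at this
      rw [inv_mul_le_iff₀ hn0]
      exact this
    rw [abs_le]
    constructor <;> linarith [h.nonneg s, h.le s]
  have hInteg : Integrable (Function.uncurry (fun (ω : Fin n → Fin d → ℝ) (s : Fin d → ℝ) =>
      |fhat d n b ω s - f s| ^ p)) (P.prod (volume.restrict (Sd d))) := by
    have : IsFiniteMeasure ((volume : Measure (Fin d → ℝ)).restrict (Sd d)) :=
      ⟨by simpa using volume_Sd_lt_top d⟩
    have hae : ∀ᵐ z ∂(P.prod (volume.restrict (Sd d))), z.2 ∈ Sd d :=
      Measure.quasiMeasurePreserving_snd.ae (ae_restrict_mem (measurableSet_Sd d))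
    refine Integrable.of_bound ?_ ((C + M) ^ p) ?_
    · have hm : Measurable (fun z : (Fin n → Fin d → ℝ) × (Fin d → ℝ) =>
          |(n:ℝ)⁻¹ * ∑ i, F (z.2, z.1 i) - f z.2| ^ p) := by
        have h1 : Measurable (fun z : (Fin n → Fin d → ℝ) × (Fin d → ℝ) => ∑ i, F (z.2, z.1 i)) :=
          Finset.measurable_sum _ fun i _ => hFm.comp
            (measurable_snd.prodMk ((measurable_pi_apply i).comp measurable_fst))
        have h2 := (h1.const_mul (n:ℝ)⁻¹).sub (h.meas.comp measurable_snd)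
        exact (measurable_norm.comp h2).pow_const p
      refine hm.aestronglyMeasurable.congr ?_
      filter_upwards [hae] with z hz
      simp only [Function.uncurry, fhat]
      simp_rw [hF z.2 hz]
    · filter_upwards [hae] with z hz
      simp only [Function.uncurry]
      rw [Real.norm_eq_abs, abs_of_nonneg (Real.rpow_nonneg (abs_nonneg _) _)]
      exact Real.rpow_le_rpow (abs_nonneg _) (hfh _ hz _) (by linarith)
  refine ⟨fun s => ∫ ω, |fhat d n b ω s - f s| ^ p ∂P, ?_, ?_, ?_⟩
  · exact hInteg.integral_prod_right
  · unfold lpRiskPow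
    rw [h.integral_pi n, ← hP]
    exact integral_integral_swap hInteg
  · intro s hs
    have hKm : Measurable (dirKb d b s) := kb_measurable
    have hKb : ∀ x, ‖dirKb d b s x‖ ≤ C := fun x => by
      rw [Real.norm_eq_abs, abs_of_nonneg (kb_nonneg hb hs x)]; exact hC s hs x
    have hKi : Integrable (dirKb d b s) (nuF f) :=
      Integrable.of_bound hKm.aestronglyMeasurable C (Eventually.of_forall hKb)
    have hK2 : MemLp (dirKb d b s) 2 (nuF f) :=
      MemLp.of_bound hKm.aestronglyMeasurable C (Eventually.of_forall hKb)
    have hsm : Measurable (fun ω : Fin n → Fin d → ℝ => ∑ i, dirKb d b s (ω i)) :=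
      Finset.measurable_sum _ fun i _ => hKm.comp (measurable_pi_apply i)
    have hfm : Measurable (fun ω : Fin n → Fin d → ℝ => fhat d n b ω s) := hsm.const_mul _
    have hZm : Measurable (fun ω : Fin n → Fin d → ℝ => fhat d n b ω s - f s) := hfm.sub_const _
    have hci : ∀ i : Fin n, Integrable (fun ω : Fin n → Fin d → ℝ => dirKb d b s (ω i)) P :=
      fun i => integrable_comp_eval (μ := fun _ : Fin n => nuF f) hKi
    have hmean : ∫ ω, (fhat d n b ω s - f s) ∂P = (∫ x, dirKb d b s x * f x) - f s := by
      have hfi : Integrable (fun ω : Fin n → Fin d → ℝ => fhat d n b ω s) P :=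
        (integrable_finsetSum _ fun i _ => hci i).const_mul _
      rw [integral_sub hfi (integrable_const _)]
      unfold fhat
      rw [integral_const_mul, integral_finsetSum _ fun i _ => hci i]
      have : ∀ i : Fin n, ∫ ω : Fin n → Fin d → ℝ, dirKb d b s (ω i) ∂P
          = ∫ x, dirKb d b s x * f x := by
        intro i
        rw [hP, integral_comp_eval (μ := fun _ : Fin n => nuF f) (f := dirKb d b s)
          hKm.aestronglyMeasurable, h.integral_nu]
      simp_rw [this]
      simp
      field_simp
    have hvar : ProbabilityTheory.variance (dirKb d b s) (nuF f)
        = (∫ x, (dirKb d b s x) ^ 2 * f x) - (∫ x, dirKb d b s x * f x) ^ 2 := by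
      rw [ProbabilityTheory.variance_eq_sub hK2, h.integral_nu, h.integral_nu]
      simp
    have hvarZ : ProbabilityTheory.variance (fun ω => fhat d n b ω s - f s) P
        = (n:ℝ)⁻¹ * ((∫ x, (dirKb d b s x) ^ 2 * f x) - (∫ x, dirKb d b s x * f x) ^ 2) := by
      rw [ProbabilityTheory.variance_sub_const hfm.aestronglyMeasurable]
      unfold fhat
      rw [ProbabilityTheory.variance_const_mul]
      have e : (fun ω : Fin n → Fin d → ℝ => ∑ i, dirKb d b s (ω i))
          = ∑ i, fun ω : Fin n → Fin d → ℝ => dirKb d b s (ω i) := by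
        ext ω; simp
      rw [e, hP, ProbabilityTheory.variance_sum_pi (μ := fun _ : Fin n => nuF f)
        (X := fun _ => dirKb d b s) (fun _ => hK2)]
      simp only [hvar, Finset.sum_const, Finset.card_univ, Fintype.card_fin, nsmul_eq_mul]
      field_simp
    refine ⟨integral_nonneg fun ω => Real.rpow_nonneg (abs_nonneg _) _, ?_, ?_, ?_⟩
    · rw [← hmean]
      exact jensen1 P _ hZm (C + M) (hfh s hs) p (by linarith)
    · rw [← hvarZ]; exact ProbabilityTheory.variance_nonneg _ _
    · rw [← hvarZ]
      have h1 := ProbabilityTheory.variance_le_expectation_sq (μ := P) hZm.aestronglyMeasurable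
      have h0 := ProbabilityTheory.variance_nonneg (fun ω => fhat d n b ω s - f s) P
      refine (Real.rpow_le_rpow h0 h1 (by linarith)).trans ?_
      have h2 := jensen1 P (fun ω => (fhat d n b ω s - f s) ^ 2) (hZm.pow_const 2) ((C + M) ^ 2)
        (fun ω => by
          rw [abs_pow]
          exact pow_le_pow_left₀ (abs_nonneg _) (hfh s hs ω) 2) (p / 2) (by linarith)
      rw [abs_of_nonneg (integral_nonneg fun ω => sq_nonneg _)] at h2
      refine h2.trans (le_of_eq ?_)
      apply integral_congr_ae
      refine Eventually.of_forall fun ω => ?_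
      simp only
      rw [abs_pow, ← Real.rpow_natCast, ← Real.rpow_mul (abs_nonneg _)]
      congr 1
      push_cast
      ring


def volR (d : ℕ) : ℝ := (volume (Sd d)).toReal

lemma Sd_box_subset (d : ℕ) (hd : 1 ≤ d) (s : Fin d → ℝ) (h : ∀ i, 0 ≤ s i ∧ s i ≤ 1 / (d:ℝ)) :
    s ∈ Sd d := by
  have hd' : (1:ℝ) ≤ d := by exact_mod_cast hd
  refine ⟨fun i => ⟨(h i).1, (h i).2.trans ?_⟩, ?_⟩
  · rw [div_le_one (by linarith)]; exact hd'
  · calc ∑ i, s i ≤ ∑ i : Fin d, 1 / (d:ℝ) := Finset.sum_le_sum fun i _ => (h i).2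
      _ = 1 := by
        simp
        field_simp

lemma volR_pos (d : ℕ) (hd : 1 ≤ d) : 0 < volR d := by
  have hd' : (1:ℝ) ≤ d := by exact_mod_cast hd
  apply ENNReal.toReal_pos _ (volume_Sd_lt_top d).ne
  have h : Set.Icc (fun _ : Fin d => (0:ℝ)) (fun _ => 1 / (d:ℝ)) ⊆ Sd d := by
    intro s hs
    exact Sd_box_subset d hd s fun i => ⟨hs.1 i, hs.2 i⟩
  intro h0
  have h1 : volume (Set.Icc (fun _ : Fin d => (0:ℝ)) (fun _ => 1 / (d:ℝ))) = 0 :=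
    measure_mono_null h h0
  rw [Real.volume_Icc_pi] at h1
  rw [Finset.prod_eq_zero_iff] at h1
  obtain ⟨i, -, hi⟩ := h1
  rw [ENNReal.ofReal_eq_zero] at hi
  have : 0 < 1 / (d:ℝ) := by positivity
  linarith

lemma volR_le_one (d : ℕ) : volR d ≤ 1 := by
  have h : Sd d ⊆ Set.Icc (fun _ : Fin d => (0:ℝ)) (fun _ => 1) := by
    intro s hs
    exact ⟨fun i => (hs.1 i).1, fun i => (hs.1 i).2⟩
  have h1 := measure_mono (μ := volume) h
  rw [Real.volume_Icc_pi] at h1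
  simp at h1
  exact ENNReal.toReal_le_of_le_ofReal zero_le_one (by simpa using h1)

def famI (d : ℕ) (i0 : Fin d) (w θ : ℝ) : ℝ := ∫ x in Sd d, Real.cos (w * x i0 + θ)

def famA (d : ℕ) (i0 : Fin d) (E w θ : ℝ) : ℝ := (1 - E * famI d i0 w θ) / volR d

def fam (d : ℕ) (i0 : Fin d) (E w θ : ℝ) : (Fin d → ℝ) → ℝ :=
  (Sd d).indicator (fun x => famA d i0 E w θ + E * Real.cos (w * x i0 + θ))

lemma famI_abs (d : ℕ) (i0 : Fin d) (w θ : ℝ) : |famI d i0 w θ| ≤ volR d := by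
  have := norm_setIntegral_le_of_norm_le_const (μ := volume) (s := Sd d)
    (f := fun x : Fin d → ℝ => Real.cos (w * x i0 + θ)) (C := 1) (volume_Sd_lt_top d)
    (fun x _ => by simpa using Real.abs_cos_le_one _)
  simpa [famI, volR, Measure.real] using this

lemma fam_integrableOn (d : ℕ) (i0 : Fin d) (w θ : ℝ) :
    IntegrableOn (fun x : Fin d → ℝ => Real.cos (w * x i0 + θ)) (Sd d) := by
  have : IsFiniteMeasure (volume.restrict (Sd d)) :=
    ⟨by rw [Measure.restrict_apply_univ]; exact volume_Sd_lt_top d⟩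
  refine Integrable.of_bound (by exact Measurable.aestronglyMeasurable (by fun_prop)) 1 (Eventually.of_forall fun x => ?_)
  simpa using Real.abs_cos_le_one _

lemma fam_int (d : ℕ) (hd : 1 ≤ d) (i0 : Fin d) (E w θ : ℝ) : ∫ x in Sd d, fam d i0 E w θ x = 1 := by
  have hV := volR_pos d hd
  rw [setIntegral_congr_fun (measurableSet_Sd d)
    (g := fun x => famA d i0 E w θ + E * Real.cos (w * x i0 + θ))
    (fun x hx => by simp [fam, hx])]
  have : IsFiniteMeasure (volume.restrict (Sd d)) :=
    ⟨by rw [Measure.restrict_apply_univ]; exact volume_Sd_lt_top d⟩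
  rw [integral_add (integrable_const _) ((fam_integrableOn d i0 w θ).const_mul E),
    integral_const_mul]
  simp only [integral_const, smul_eq_mul, measureReal_restrict_apply_univ]
  change volR d * famA d i0 E w θ + E * famI d i0 w θ = 1
  rw [famA]
  field_simp
  ring

lemma fam_bounds (d : ℕ) (hd : 1 ≤ d) (i0 : Fin d) (E w θ : ℝ) (hE : |E| ≤ 1 / 2) :
    |E| ≤ famA d i0 E w θ ∧ famA d i0 E w θ ≤ 1 / volR d + 1 / 2 := by
  have hV := volR_pos d hd
  have hV1 := volR_le_one d
  have hI := famI_abs d i0 w θ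
  have h1 : |E * famI d i0 w θ| ≤ 1 / 2 * volR d := by
    rw [abs_mul]; exact mul_le_mul hE hI (abs_nonneg _) (by norm_num)
  have h2 := abs_le.1 h1
  constructor
  · rw [famA, le_div_iff₀ hV]
    have : |E| * volR d ≤ 1 / 2 * 1 := mul_le_mul hE hV1 hV.le (by norm_num)
    linarith
  · rw [famA, div_le_iff₀ hV]
    have : (1 / volR d + 1 / 2) * volR d = 1 + 1 / 2 * volR d := by field_simp
    rw [this]
    linarith

lemma fam_good (d : ℕ) (hd : 1 ≤ d) (i0 : Fin d) (E w θ : ℝ) (hE : |E| ≤ 1 / 2) :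
    GoodF d (fam d i0 E w θ) (1 / volR d + 1) := by
  have hV := volR_pos d hd
  obtain ⟨h1, h2⟩ := fam_bounds d hd i0 E w θ hE
  have h3 : ∀ y : ℝ, |E * Real.cos y| ≤ |E| := by
    intro y; rw [abs_mul]; exact mul_le_of_le_one_right (abs_nonneg _) (Real.abs_cos_le_one _)
  refine ⟨?_, ?_, ?_, ?_⟩
  · exact Measurable.indicator (by fun_prop) (measurableSet_Sd d)
  · intro x
    refine Set.indicator_nonneg (fun x _ => ?_) x
    have := (abs_le.1 (h3 (w * x i0 + θ))).1
    linarith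
  · intro x
    have := (abs_le.1 (h3 (w * x i0 + θ))).2
    by_cases hx : x ∈ Sd d
    · simp only [fam, hx, Set.indicator_of_mem]
      linarith
    · simp only [fam, hx, not_false_eq_true, Set.indicator_of_notMem]
      positivity
  · rw [← fam_int d hd i0 E w θ]
    symm
    exact setIntegral_eq_integral_of_forall_compl_eq_zero fun x hx => by simp [fam, hx]

lemma cos_holder {g : ℝ} (hg0 : 0 < g) (hg1 : g ≤ 1) {y D : ℝ} (h1 : D ≤ 2) (h2 : D ≤ |y|) :
    D ≤ 2 * |y| ^ g := by
  by_cases hy : |y| ≤ 1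
  · have : |y| ≤ |y| ^ g := Real.self_le_rpow_of_le_one (abs_nonneg _) hy hg1
    have : 0 ≤ |y| := abs_nonneg _
    linarith
  · have := Real.one_le_rpow (not_le.1 hy).le hg0.le
    linarith

lemma abs_cos_sub_le (a b : ℝ) : |Real.cos a - Real.cos b| ≤ |a - b| := by
  have := Real.lipschitzWith_cos.dist_le_mul a b
  simpa [Real.dist_eq] using this

lemma abs_sin_sub_le (a b : ℝ) : |Real.sin a - Real.sin b| ≤ |a - b| := by
  have := Real.lipschitzWith_sin.dist_le_mul a b
  simpa [Real.dist_eq] using this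

lemma fam_holder (d : ℕ) (hd : 1 ≤ d) (i0 : Fin d) (E w θ β L : ℝ) (hE : |E| ≤ 1 / 2)
    (hw : 0 < w) (hβ1 : 0 < β) (hβ2 : β ≤ 2) (hL : 2 * |E| * w ^ β ≤ L) :
    fam d i0 E w θ ∈ holderClass d β L := by
  have hgood := fam_good d hd i0 E w θ hE
  have hEq : Set.EqOn (fam d i0 E w θ) (fun x => famA d i0 E w θ + E * Real.cos (w * x i0 + θ))
      (interior (Sd d)) := by
    intro x hx
    have : x ∈ Sd d := interior_subset hx
    simp [fam, this]
  refine ⟨hgood.nonneg, fun s hs => by simp [fam, hs], fam_int d hd i0 E w θ, ?_, ?_⟩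
  · refine ContDiffOn.congr (ContDiff.contDiffOn ?_) hEq
    fun_prop
  have key : ∀ s t : Fin d → ℝ, ∀ g : ℝ, 0 < g → |w * s i0 - w * t i0| ^ g ≤
      w ^ g * (∑ i, |s i - t i|) ^ g := by
    intro s t g hg
    rw [← Real.mul_rpow hw.le (by positivity), ← mul_sub, abs_mul, abs_of_pos hw]
    refine Real.rpow_le_rpow (by positivity) (mul_le_mul_of_nonneg_left ?_ hw.le) hg.le
    exact Finset.single_le_sum (f := fun i => |s i - t i|) (fun i _ => abs_nonneg _) (Finset.mem_univ i0)
  by_cases hβ : β ≤ 1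
  · have hm : mOf β = 0 := by
      have : ⌈β⌉₊ ≤ 1 := Nat.ceil_le.2 (by simpa using hβ)
      unfold mOf; omega
    rw [hm]
    intro v s hs t ht
    simp only [Dpartial, iteratedFDerivWithin_zero_apply]
    rw [hEq hs, hEq ht]
    simp only [Nat.cast_zero, sub_zero]
    rw [add_sub_add_left_eq_sub, ← mul_sub, abs_mul]
    have h1 : |Real.cos (w * s i0 + θ) - Real.cos (w * t i0 + θ)| ≤ 2 * |w * s i0 - w * t i0| ^ β := by
      apply cos_holder hβ1 hβ
      · refine (abs_sub _ _).trans ?_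
        have := Real.abs_cos_le_one (w * s i0 + θ)
        have := Real.abs_cos_le_one (w * t i0 + θ)
        linarith
      · refine (abs_cos_sub_le _ _).trans ?_
        rw [add_sub_add_right_eq_sub]
    have h2 := key s t β hβ1
    calc _ ≤ |E| * (2 * (w ^ β * (∑ i, |s i - t i|) ^ β)) := by gcongr; linarith
      _ = 2 * |E| * w ^ β * (∑ i, |s i - t i|) ^ β := by ring
      _ ≤ _ := by gcongr
  · push Not at hβ
    have hm : mOf β = 1 := by
      have h1 : ⌈β⌉₊ ≤ 2 := Nat.ceil_le.2 (by simpa using hβ2)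
      have h2 : 1 < ⌈β⌉₊ := Nat.lt_ceil.2 (by simpa using hβ)
      unfold mOf; omega
    rw [hm]
    have hD : ∀ v : Fin 1 → Fin d, ∀ s ∈ interior (Sd d), Dpartial d 1 (fam d i0 E w θ) v s =
        E * (-Real.sin (w * s i0 + θ) * w) * (Pi.single (v 0) (1:ℝ) : Fin d → ℝ) i0 := by
      intro v s hs
      have hd1 : HasFDerivAt (fun x : Fin d → ℝ => famA d i0 E w θ + E * Real.cos (w * x i0 + θ))
          ((E * (-Real.sin (w * s i0 + θ) * w)) • (ContinuousLinearMap.proj (R := ℝ) (φ := fun _ : Fin d => ℝ) i0)) s := by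
        have ha : HasDerivAt (fun y : ℝ => famA d i0 E w θ + E * Real.cos (w * y + θ))
            (E * (-Real.sin (w * s i0 + θ) * w)) (s i0) := by
          have h0 : HasDerivAt (fun y : ℝ => w * y + θ) w (s i0) := by
            simpa using ((hasDerivAt_id (s i0)).const_mul w).add_const θ
          exact (h0.cos.const_mul E).const_add _
        have hp0 : HasFDerivAt (fun x : Fin d → ℝ => x i0)
            (ContinuousLinearMap.proj (R := ℝ) (φ := fun _ : Fin d => ℝ) i0) s :=
          hasFDerivAt_apply i0 s
        have hc := HasDerivAt.comp_hasFDerivAt (f := fun x : Fin d → ℝ => x i0) s ha hp0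
        exact hc
      unfold Dpartial
      rw [iteratedFDerivWithin_one_apply (isOpen_interior.uniqueDiffWithinAt hs),
        fderivWithin_congr hEq (hEq hs), fderivWithin_of_isOpen isOpen_interior hs, hd1.fderiv]
      simp
    intro v s hs t ht
    rw [hD v s hs, hD v t ht]
    have hsg : |(Pi.single (v 0) (1:ℝ) : Fin d → ℝ) i0| ≤ 1 := by
      by_cases hv : i0 = v 0
      · subst hv; simp
      · simp [hv]
    have hb0 : 0 < β - 1 := by linarith
    have h1 : |Real.sin (w * t i0 + θ) - Real.sin (w * s i0 + θ)| ≤ 2 * |w * s i0 - w * t i0| ^ (β - 1) := by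
      apply cos_holder hb0 (by linarith)
      · refine (abs_sub _ _).trans ?_
        have := Real.abs_sin_le_one (w * s i0 + θ)
        have := Real.abs_sin_le_one (w * t i0 + θ)
        linarith
      · refine (abs_sin_sub_le _ _).trans ?_
        rw [add_sub_add_right_eq_sub, abs_sub_comm]
    have h2 := key s t (β - 1) hb0
    have e : E * (-Real.sin (w * s i0 + θ) * w) * (Pi.single (v 0) (1:ℝ) : Fin d → ℝ) i0 -
        E * (-Real.sin (w * t i0 + θ) * w) * (Pi.single (v 0) (1:ℝ) : Fin d → ℝ) i0 =
        E * w * (Real.sin (w * t i0 + θ) - Real.sin (w * s i0 + θ)) *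
          (Pi.single (v 0) (1:ℝ) : Fin d → ℝ) i0 := by ring
    rw [e, abs_mul, abs_mul, abs_mul, abs_of_pos hw, Nat.cast_one]
    have hww : w * w ^ (β - 1) = w ^ β := by
      rw [← Real.rpow_one_add' hw.le (by linarith)]; congr 1; ring
    calc _ ≤ |E| * w * (2 * (w ^ (β - 1) * (∑ i, |s i - t i|) ^ (β - 1))) * 1 := by gcongr; linarith
      _ = 2 * |E| * (w * w ^ (β - 1)) * (∑ i, |s i - t i|) ^ (β - 1) := by ring
      _ ≤ _ := by rw [hww]; gcongr


lemma one_sub_cos_lower (y : ℝ) : y ^ 2 / 2 - y ^ 4 / 2 ≤ 1 - Real.cos y := by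
  by_cases hy : |y| ≤ 1
  · have h := (abs_le.1 (Real.cos_bound hy)).2
    have e : |y| ^ 4 = y ^ 4 := by
      rw [show (4:ℕ) = 2 * 2 by norm_num, pow_mul, pow_mul, sq_abs]
    rw [e] at h
    nlinarith [pow_nonneg (sq_nonneg y) 2]
  · push Not at hy
    have h1 : 1 < y ^ 2 := by rw [← sq_abs]; nlinarith
    have h2 := Real.cos_le_one y
    nlinarith

lemma Sd_diff {d : ℕ} {x s : Fin d → ℝ} (hx : x ∈ Sd d) (hs : s ∈ Sd d) (i : Fin d) (k : ℕ) :
    |(x i - s i) ^ k| ≤ 1 := by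
  rw [abs_pow]
  apply pow_le_one₀ (abs_nonneg _)
  rw [abs_le]
  have := hx.1 i
  have := hs.1 i
  constructor <;> linarith

lemma kb_cos_lower (d : ℕ) (hd : 1 ≤ d) : ∃ κ c0 : ℝ, 0 < κ ∧ 0 < c0 ∧ ∀ (b : ℝ) (s : Fin d → ℝ)
    (i : Fin d), 0 < b → b < 1 → s ∈ Sd d → 1 / (4 * (d:ℝ)) ≤ s i → s i ≤ 1 / (2 * (d:ℝ)) →
    c0 ≤ ∫ x, (1 - Real.cos (κ / √b * (x i - s i))) * dirKb d b s x := by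
  obtain ⟨C, hC0, hC⟩ := kb_fourth d
  have hd' : (1:ℝ) ≤ d := by exact_mod_cast hd
  set a : ℝ := 1 / (8 * d) / ((d:ℝ) + 3) ^ 2 with ha
  have ha0 : 0 < a := by positivity
  refine ⟨√(a / (2 * C)), a ^ 2 / (8 * C), Real.sqrt_pos.2 (by positivity), by positivity, ?_⟩
  intro b s i hb hb1 hs hs1 hs2
  set κ := √(a / (2 * C)) with hκ
  have hκ2 : κ ^ 2 = a / (2 * C) := Real.sq_sqrt (by positivity)
  set w := κ / √b with hw
  have hw2 : w ^ 2 = κ ^ 2 / b := by rw [hw, div_pow, Real.sq_sqrt hb.le]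
  have hI2 : Integrable (fun x => (x i - s i) ^ 2 * dirKb d b s x) :=
    kb_integrable hb hs (fun x => (x i - s i) ^ 2) (by fun_prop) 1 fun x hx => Sd_diff hx hs i 2
  have hI4 : Integrable (fun x => (x i - s i) ^ 4 * dirKb d b s x) :=
    kb_integrable hb hs (fun x => (x i - s i) ^ 4) (by fun_prop) 1 fun x hx => Sd_diff hx hs i 4
  have hIc : Integrable (fun x => (1 - Real.cos (w * (x i - s i))) * dirKb d b s x) :=
    kb_integrable hb hs (fun x => 1 - Real.cos (w * (x i - s i))) (by fun_prop) 2 fun x hx => by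
      have h1 := Real.cos_le_one (w * (x i - s i))
      have h2 := Real.neg_one_le_cos (w * (x i - s i))
      rw [abs_le]; constructor <;> linarith
  have hmono : ∫ x, (w ^ 2 / 2 * ((x i - s i) ^ 2 * dirKb d b s x)
      - w ^ 4 / 2 * ((x i - s i) ^ 4 * dirKb d b s x)) ≤
      ∫ x, (1 - Real.cos (w * (x i - s i))) * dirKb d b s x := by
    apply integral_mono ((hI2.const_mul _).sub (hI4.const_mul _)) hIc
    intro x
    have h1 := one_sub_cos_lower (w * (x i - s i))
    have h2 := mul_le_mul_of_nonneg_right h1 (kb_nonneg hb hs x)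
    refine le_trans (le_of_eq ?_) h2
    simp only [Pi.sub_apply]
    ring
  refine le_trans ?_ hmono
  rw [integral_sub (hI2.const_mul _) (hI4.const_mul _), integral_const_mul, integral_const_mul]
  have l2 := kb_second_lower hb hb1 hs i
  have u4 := hC b s i hb hb1 hs
  have hss : 1 / (8 * (d:ℝ)) ≤ s i * (1 - s i) := by
    have h1 : 1 / (2 * (d:ℝ)) ≤ 1 / 2 := by
      apply one_div_le_one_div_of_le <;> linarith
    have h2 : 1 / (8 * (d:ℝ)) = 1 / (4 * (d:ℝ)) * (1 / 2) := by field_simp; norm_num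
    rw [h2]
    apply mul_le_mul hs1 (by linarith) (by norm_num)
    exact le_trans (by positivity) hs1
  have l2' : b * a ≤ ∫ x, (x i - s i) ^ 2 * dirKb d b s x := by
    refine le_trans ?_ l2
    rw [ha, mul_div_assoc]
    gcongr
  have m1 : w ^ 2 / 2 * (b * a) ≤ w ^ 2 / 2 * ∫ x, (x i - s i) ^ 2 * dirKb d b s x := by gcongr
  have m2 : w ^ 4 / 2 * ∫ x, (x i - s i) ^ 4 * dirKb d b s x ≤ w ^ 4 / 2 * (C * b ^ 2) := by gcongr
  have e4 : w ^ 4 = (w ^ 2) ^ 2 := by ring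
  have : w ^ 2 / 2 * (b * a) - w ^ 4 / 2 * (C * b ^ 2) = a ^ 2 / (8 * C) := by
    rw [e4, hw2, hκ2]
    field_simp
    ring
  linarith

lemma kb_cos_integrable {d : ℕ} {b : ℝ} (hb : 0 < b) {s : Fin d → ℝ} (hs : s ∈ Sd d) (i : Fin d)
    (w θ : ℝ) : Integrable (fun x => Real.cos (w * x i + θ) * dirKb d b s x) :=
  kb_integrable hb hs (fun x => Real.cos (w * x i + θ)) (by fun_prop) 1
    fun x _ => Real.abs_cos_le_one _

lemma kb_int {d : ℕ} {b : ℝ} (hb : 0 < b) {s : Fin d → ℝ} (hs : s ∈ Sd d) :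
    Integrable (fun x => dirKb d b s x) := by
  have := kb_integrable hb hs (fun _ => 1) (by fun_prop) 1 (fun x _ => by simp)
  simpa using this

lemma kb_mul_fam {d : ℕ} (b : ℝ) (s : Fin d → ℝ) (i0 : Fin d) (E w θ : ℝ) (x : Fin d → ℝ) :
    dirKb d b s x * fam d i0 E w θ x =
      dirKb d b s x * (famA d i0 E w θ + E * Real.cos (w * x i0 + θ)) := by
  by_cases hx : x ∈ Sd d
  · simp [fam, hx]
  · have : dirKb d b s x = 0 := by simp [dirKb, dirK, hx]
    simp [this]

lemma fam_bias {d : ℕ} {b : ℝ} (hb : 0 < b) {s : Fin d → ℝ} (hs : s ∈ Sd d) (i0 : Fin d)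
    (E w θ : ℝ) : (∫ x, dirKb d b s x * fam d i0 E w θ x) - fam d i0 E w θ s =
      E * ((∫ x, Real.cos (w * x i0 + θ) * dirKb d b s x) - Real.cos (w * s i0 + θ)) := by
  have e : ∀ x, dirKb d b s x * fam d i0 E w θ x =
      famA d i0 E w θ * dirKb d b s x + E * (Real.cos (w * x i0 + θ) * dirKb d b s x) := by
    intro x; rw [kb_mul_fam]; ring
  simp_rw [e]
  rw [integral_add ((kb_int hb hs).const_mul _) ((kb_cos_integrable hb hs i0 w θ).const_mul _),
    integral_const_mul, integral_const_mul, kb_integral hb hs]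
  simp only [fam, hs, Set.indicator_of_mem]
  ring

lemma two_phase {d : ℕ} {b : ℝ} (hb : 0 < b) {s : Fin d → ℝ} (hs : s ∈ Sd d) (i : Fin d) (w : ℝ) :
    ∫ x, (1 - Real.cos (w * (x i - s i))) * dirKb d b s x ≤
      |(∫ x, Real.cos (w * x i + 0) * dirKb d b s x) - Real.cos (w * s i + 0)| +
      |(∫ x, Real.cos (w * x i + (-(Real.pi / 2))) * dirKb d b s x)
        - Real.cos (w * s i + (-(Real.pi / 2)))| := by
  have i1 := kb_cos_integrable hb hs i w 0
  have i2 := kb_cos_integrable hb hs i w (-(Real.pi / 2))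
  set D0 := (∫ x, Real.cos (w * x i + 0) * dirKb d b s x) with hD0
  set D1 := (∫ x, Real.cos (w * x i + (-(Real.pi / 2))) * dirKb d b s x) with hD1
  have e : ∀ x : Fin d → ℝ, (1 - Real.cos (w * (x i - s i))) * dirKb d b s x =
      dirKb d b s x - Real.cos (w * s i) * (Real.cos (w * x i + 0) * dirKb d b s x)
        - Real.sin (w * s i) * (Real.cos (w * x i + (-(Real.pi / 2))) * dirKb d b s x) := by
    intro x
    have : Real.cos (w * x i + (-(Real.pi / 2))) = Real.sin (w * x i) := by
      rw [← sub_eq_add_neg, Real.cos_sub_pi_div_two]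
    rw [this, add_zero, mul_sub, Real.cos_sub]
    ring
  simp_rw [e]
  have i3 : Integrable (fun x => dirKb d b s x
      - Real.cos (w * s i) * (Real.cos (w * x i + 0) * dirKb d b s x)) :=
    (kb_int hb hs).sub (i1.const_mul _)
  rw [integral_sub i3 (i2.const_mul _),
    integral_sub (kb_int hb hs) (i1.const_mul _), integral_const_mul, integral_const_mul,
    kb_integral hb hs, ← hD0, ← hD1]
  have h3 : Real.cos (w * s i + (-(Real.pi / 2))) = Real.sin (w * s i) := by
    rw [← sub_eq_add_neg, Real.cos_sub_pi_div_two]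
  rw [h3, add_zero]
  have h4 := Real.sin_sq_add_cos_sq (w * s i)
  have h5 : -(Real.cos (w * s i) * (D0 - Real.cos (w * s i))) ≤ |D0 - Real.cos (w * s i)| := by
    refine (neg_le_abs _).trans ?_
    rw [abs_mul]
    exact mul_le_of_le_one_left (abs_nonneg _) (Real.abs_cos_le_one _)
  have h6 : -(Real.sin (w * s i) * (D1 - Real.sin (w * s i))) ≤ |D1 - Real.sin (w * s i)| := by
    refine (neg_le_abs _).trans ?_
    rw [abs_mul]
    exact mul_le_of_le_one_left (abs_nonneg _) (Real.abs_sin_le_one _)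
  nlinarith

lemma bias_lemma (d : ℕ) (hd : 1 ≤ d) (p β L : ℝ)
    (hp : 4 ≤ p) (hβ1 : 0 < β) (hβ2 : β ≤ 2) (hL : 0 < L) :
    ∃ c : ℝ, 0 < c ∧ ∀ (n : ℕ) (b : ℝ), 1 ≤ n → 0 < b → b < 1 →
      ∃ f ∈ holderClass d β L, (c * b ^ (β / 2)) ^ p ≤ lpRiskPow d n b p f := by
  obtain ⟨κ, c0, hκ, hc0, hcos⟩ := kb_cos_lower d hd
  have hd' : (1:ℝ) ≤ d := by exact_mod_cast hd
  set ε : ℝ := min (1 / 2) (L / (2 * κ ^ β)) with hε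
  have hε0 : 0 < ε := lt_min (by norm_num) (by positivity)
  set B : Set (Fin d → ℝ) := Set.Icc (fun _ => 1 / (4 * (d:ℝ))) (fun _ => 1 / (2 * (d:ℝ))) with hB
  have hBsub : B ⊆ Sd d := by
    intro s hs
    refine Sd_box_subset d hd s fun i => ⟨le_trans (by positivity) (hs.1 i), (hs.2 i).trans ?_⟩
    apply one_div_le_one_div_of_le <;> linarith
  have hBm : MeasurableSet B := measurableSet_Icc
  have hBfin : volume B ≠ ⊤ := (measure_mono hBsub |>.trans_lt (volume_Sd_lt_top d)).ne
  have hBpos : 0 < volume.real B := by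
    apply ENNReal.toReal_pos _ hBfin
    rw [hB, Real.volume_Icc_pi, Finset.prod_ne_zero_iff]
    intro i _
    have : 0 < 1 / (2 * (d:ℝ)) - 1 / (4 * (d:ℝ)) := by
      have : 1 / (2 * (d:ℝ)) - 1 / (4 * (d:ℝ)) = 1 / (4 * (d:ℝ)) := by field_simp; norm_num
      rw [this]; positivity
    simpa using this
  set v := volume.real B / 2 with hv
  have hv0 : 0 < v := by positivity
  have hi : 0 < d := hd
  set i0 : Fin d := ⟨0, hi⟩
  refine ⟨v ^ (1 / p) * (ε * (c0 / 2)), by positivity, ?_⟩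
  intro n b hn hb hb1
  set E := ε * b ^ (β / 2) with hE
  have hE0 : 0 < E := by positivity
  have hE1 : |E| ≤ 1 / 2 := by
    rw [abs_of_pos hE0]
    have h1 : b ^ (β / 2) ≤ 1 := Real.rpow_le_one hb.le hb1.le (by positivity)
    have h2 : ε ≤ 1 / 2 := min_le_left _ _
    nlinarith
  set w := κ / √b with hw
  have hsb : 0 < √b := Real.sqrt_pos.2 hb
  have hw0 : 0 < w := by positivity
  have hsbβ : √b ^ β = b ^ (β / 2) := by
    rw [Real.sqrt_eq_rpow, ← Real.rpow_mul hb.le]; congr 1; ring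
  have hLw : 2 * |E| * w ^ β ≤ L := by
    rw [abs_of_pos hE0, hw, Real.div_rpow hκ.le hsb.le, hsbβ, hE]
    have h1 : ε ≤ L / (2 * κ ^ β) := min_le_right _ _
    rw [le_div_iff₀ (by positivity)] at h1
    have h2 : 2 * (ε * b ^ (β / 2)) * (κ ^ β / b ^ (β / 2)) = ε * (2 * κ ^ β) := by
      have : b ^ (β / 2) ≠ 0 := by positivity
      field_simp
    rw [h2]; exact h1
  have hmem : ∀ θ, fam d i0 E w θ ∈ holderClass d β L := fun θ =>
    fam_holder d hd i0 E w θ β L hE1 hw0 hβ1 hβ2 hLw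
  obtain ⟨R0, hR0i, hR0, hR0s⟩ := risk_repr (fam_good d hd i0 E w 0 hE1) hn hb (p := p) (by linarith)
  obtain ⟨R1, hR1i, hR1, hR1s⟩ :=
    risk_repr (fam_good d hd i0 E w (-(Real.pi / 2)) hE1) hn hb (p := p) (by linarith)
  have hpt : ∀ s ∈ B, (E * (c0 / 2)) ^ p ≤ R0 s + R1 s := by
    intro s hs
    have hsS := hBsub hs
    have h1 := (hcos b s i0 hb hb1 hsS (hs.1 i0) (hs.2 i0)).trans (two_phase hb hsS i0 w)
    obtain ⟨n0, p0, -⟩ := hR0s s hsS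
    obtain ⟨n1, p1, -⟩ := hR1s s hsS
    rw [fam_bias hb hsS, abs_mul, abs_of_pos hE0] at p0 p1
    set x0 := |(∫ x, Real.cos (w * x i0 + 0) * dirKb d b s x) - Real.cos (w * s i0 + 0)|
    set x1 := |(∫ x, Real.cos (w * x i0 + (-(Real.pi / 2))) * dirKb d b s x)
        - Real.cos (w * s i0 + (-(Real.pi / 2)))|
    by_cases hx : c0 / 2 ≤ x0
    · have : (E * (c0 / 2)) ^ p ≤ (E * x0) ^ p := by gcongr
      linarith
    · have hx' : c0 / 2 ≤ x1 := by linarith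
      have : (E * (c0 / 2)) ^ p ≤ (E * x1) ^ p := by gcongr
      linarith
  have hsum : volume.real B * (E * (c0 / 2)) ^ p ≤
      lpRiskPow d n b p (fam d i0 E w 0) + lpRiskPow d n b p (fam d i0 E w (-(Real.pi / 2))) := by
    rw [hR0, hR1, ← integral_add hR0i hR1i]
    calc _ = ∫ s in B, (E * (c0 / 2)) ^ p := by simp
      _ ≤ ∫ s in B, (R0 s + R1 s) := by
        refine setIntegral_mono_on (integrableOn_const hBfin) ((hR0i.add hR1i).mono_set hBsub) hBm hpt
      _ ≤ _ := by
        refine setIntegral_mono_set (hR0i.add hR1i) ?_ hBsub.eventuallyLE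
        refine (ae_restrict_iff' (measurableSet_Sd d)).2 (Eventually.of_forall fun s hs => ?_)
        have := (hR0s s hs).1
        have := (hR1s s hs).1
        simp only [Pi.zero_apply]
        linarith
  have hpow : (v ^ (1 / p) * (ε * (c0 / 2)) * b ^ (β / 2)) ^ p = v * (E * (c0 / 2)) ^ p := by
    rw [show v ^ (1 / p) * (ε * (c0 / 2)) * b ^ (β / 2) = v ^ (1 / p) * (E * (c0 / 2)) by rw [hE]; ring,
      Real.mul_rpow (by positivity) (by positivity), ← Real.rpow_mul hv0.le,
      one_div_mul_cancel (by linarith), Real.rpow_one]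
  rw [hpow]
  by_cases hx : v * (E * (c0 / 2)) ^ p ≤ lpRiskPow d n b p (fam d i0 E w 0)
  · exact ⟨_, hmem 0, hx⟩
  · refine ⟨_, hmem (-(Real.pi / 2)), ?_⟩
    have : volume.real B * (E * (c0 / 2)) ^ p = v * (E * (c0 / 2)) ^ p + v * (E * (c0 / 2)) ^ p := by
      rw [hv]; ring
    linarith


lemma kb_sq_int {d : ℕ} {b : ℝ} (hb : 0 < b) {s : Fin d → ℝ} (hs : s ∈ Sd d) :
    Integrable (fun x => dirKb d b s x ^ 2) := by
  obtain ⟨C, hC0, hC⟩ := kb_bound d hb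
  have := kb_integrable hb hs (dirKb d b s) kb_measurable C (fun x _ => by
    rw [abs_of_nonneg (kb_nonneg hb hs x)]; exact hC s hs x)
  simpa [sq] using this

lemma kb_sq_lower {d : ℕ} (hd : 1 ≤ d) {b : ℝ} (hb : 0 < b) (hb1 : b < 1) {s : Fin d → ℝ}
    (hs : s ∈ Sd d) :
    1 / (4 * ∏ i, (2 * √(2 * d * ((d:ℝ) + 3) ^ 2 * (b * (s i + b))))) ≤ ∫ x, dirKb d b s x ^ 2 := by
  have hd' : (1:ℝ) ≤ d := by exact_mod_cast hd
  set w : Fin d → ℝ := fun i => √(2 * d * ((d:ℝ) + 3) ^ 2 * (b * (s i + b))) with hw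
  have hsb : ∀ i, 0 < s i + b := fun i => by have := (hs.1 i).1; linarith
  have hw0 : ∀ i, 0 < w i := fun i => Real.sqrt_pos.2 (by have := hsb i; positivity)
  have hw2 : ∀ i, w i ^ 2 = 2 * d * ((d:ℝ) + 3) ^ 2 * (b * (s i + b)) := fun i =>
    Real.sq_sqrt (by have := hsb i; positivity)
  change 1 / (4 * ∏ i, (2 * w i)) ≤ _
  set V := ∏ i, (2 * w i) with hV
  have hV0 : 0 < V := Finset.prod_pos fun i _ => by have := hw0 i; positivity
  set A : Set (Fin d → ℝ) := Set.Icc (s - w) (s + w) with hA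
  have hAm : MeasurableSet A := measurableSet_Icc
  have hAv : volume.real A = V := by
    rw [Measure.real, hA, Real.volume_Icc_pi, ENNReal.toReal_prod, hV]
    refine Finset.prod_congr rfl fun i _ => ?_
    have := hw0 i
    rw [ENNReal.toReal_ofReal]
    · simp only [Pi.add_apply, Pi.sub_apply]; ring
    · simp only [Pi.add_apply, Pi.sub_apply]; linarith
  have hAfin : volume A ≠ ⊤ := isCompact_Icc.measure_lt_top.ne
  set one : (Fin d → ℝ) → ℝ := A.indicator (fun _ => 1) with hone
  have hom : Measurable one := measurable_const.indicator hAm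
  have hoi : Integrable one := by
    rw [hone, integrable_indicator_iff hAm]; exact integrableOn_const hAfin
  have hoint : ∫ x, one x = V := by
    rw [hone, integral_indicator hAm]; simp [hAv]
  have hKo : Integrable (fun x => one x * dirKb d b s x) :=
    kb_integrable hb hs one hom 1 fun x _ => by
      simp only [hone, Set.indicator]; split_ifs <;> simp
  have hI2 : ∀ i, Integrable (fun x => (x i - s i) ^ 2 * dirKb d b s x) := fun i =>
    kb_integrable hb hs (fun x => (x i - s i) ^ 2) (by fun_prop) 1 fun x hx => Sd_diff hx hs i 2
  have hhalf : 1 / 2 ≤ ∫ x, one x * dirKb d b s x := by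
    have hsumI : Integrable (fun x => ∑ i, (w i ^ 2)⁻¹ * ((x i - s i) ^ 2 * dirKb d b s x)) :=
      integrable_finsetSum _ fun i _ => (hI2 i).const_mul _
    have h1 : ∫ x, (dirKb d b s x - ∑ i, (w i ^ 2)⁻¹ * ((x i - s i) ^ 2 * dirKb d b s x)) ≤
        ∫ x, one x * dirKb d b s x := by
      apply integral_mono ((kb_int hb hs).sub hsumI) hKo
      intro x
      have hK := kb_nonneg hb hs x
      have hnn : ∀ i ∈ Finset.univ, 0 ≤ (w i ^ 2)⁻¹ * ((x i - s i) ^ 2 * dirKb d b s x) :=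
        fun i _ => by positivity
      simp only [Pi.sub_apply]
      by_cases hx : x ∈ A
      · have := Finset.sum_nonneg hnn
        simp only [hone, hx, Set.indicator_of_mem]
        linarith
      · simp only [hone, hx, not_false_eq_true, Set.indicator_of_notMem]
        have : ∃ i, w i < |x i - s i| := by
          by_contra hcon
          push Not at hcon
          apply hx
          constructor
          · intro i
            have := (abs_le.1 (hcon i)).1
            simp only [Pi.sub_apply]; linarith
          · intro i
            have := (abs_le.1 (hcon i)).2
            simp only [Pi.add_apply]; linarith
        obtain ⟨i, hi⟩ := this
        have h2 := Finset.single_le_sum hnn (Finset.mem_univ i)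
        have h3 : w i ^ 2 ≤ (x i - s i) ^ 2 := by
          rw [← sq_abs (x i - s i)]
          exact pow_le_pow_left₀ (hw0 i).le hi.le 2
        have h4 : 1 ≤ (w i ^ 2)⁻¹ * (x i - s i) ^ 2 := by
          rw [inv_mul_eq_div, le_div_iff₀ (by have := hw0 i; positivity)]; linarith
        have h5 := mul_le_mul_of_nonneg_right h4 hK
        linarith
    refine le_trans ?_ h1
    rw [integral_sub (kb_int hb hs) hsumI, kb_integral hb hs,
      integral_finsetSum _ fun i _ => (hI2 i).const_mul _]
    have h6 : ∑ i, ∫ x, (w i ^ 2)⁻¹ * ((x i - s i) ^ 2 * dirKb d b s x) ≤ ∑ i : Fin d, 1 / (2 * (d:ℝ)) := by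
      refine Finset.sum_le_sum fun i _ => ?_
      rw [integral_const_mul]
      have h7 := kb_second_upper hb hb1 hs i
      have h8 := hsb i
      calc _ ≤ (w i ^ 2)⁻¹ * (((d:ℝ) + 3) ^ 2 * (b * (s i + b))) := by gcongr
        _ = _ := by
          rw [hw2]; field_simp
    have h9 : ∑ i : Fin d, 1 / (2 * (d:ℝ)) = 1 / 2 := by
      simp
      field_simp
    linarith
  set l := 1 / (2 * V) with hl
  have hmono : ∫ x, (2 * l * (one x * dirKb d b s x) - l ^ 2 * one x) ≤ ∫ x, dirKb d b s x ^ 2 := by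
    apply integral_mono ((hKo.const_mul _).sub (hoi.const_mul _)) (kb_sq_int hb hs)
    intro x
    simp only [Pi.sub_apply]
    by_cases hx : x ∈ A
    · simp only [hone, hx, Set.indicator_of_mem]
      nlinarith [sq_nonneg (dirKb d b s x - l)]
    · simp only [hone, hx, not_false_eq_true, Set.indicator_of_notMem]
      nlinarith [sq_nonneg (dirKb d b s x)]
  refine le_trans ?_ hmono
  rw [integral_sub (hKo.const_mul _) (hoi.const_mul _), integral_const_mul, integral_const_mul, hoint]
  have hl0 : 0 < l := by positivity
  have h1 : 2 * l * (1 / 2) ≤ 2 * l * ∫ x, one x * dirKb d b s x := by gcongr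
  have h2 : 2 * l * (1 / 2) - l ^ 2 * V = 1 / (4 * V) := by
    rw [hl]; field_simp; norm_num
  linarith

lemma w_prod_le (d : ℕ) (hd : 1 ≤ d) : ∃ C : ℝ, 0 < C ∧ ∀ (b : ℝ) (s : Fin d → ℝ) (i0 : Fin d), 0 < b →
    b < 1 → s ∈ Sd d →
    ∏ i, (2 * √(2 * d * ((d:ℝ) + 3) ^ 2 * (b * (s i + b)))) ≤ C * √b ^ d * √(s i0 + b) := by
  set G : ℝ := 2 * √(2 * d * ((d:ℝ) + 3) ^ 2) with hG
  have hd' : (1:ℝ) ≤ d := by exact_mod_cast hd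
  have hG0 : 0 < G := by
    have := Real.sqrt_pos.2 (show 0 < 2 * d * ((d:ℝ) + 3) ^ 2 by positivity)
    positivity
  have h2 : 0 < √(2:ℝ) := Real.sqrt_pos.2 (by norm_num)
  refine ⟨G ^ d * √2 ^ (d - 1), by positivity, ?_⟩
  intro b s i0 hb hb1 hs
  have e : ∀ i, 2 * √(2 * d * ((d:ℝ) + 3) ^ 2 * (b * (s i + b))) = G * √b * √(s i + b) := by
    intro i
    rw [Real.sqrt_mul (by positivity), Real.sqrt_mul hb.le, hG]; ring
  simp_rw [e]
  rw [← Finset.mul_prod_erase _ _ (Finset.mem_univ i0)]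
  have h3 : ∏ i ∈ Finset.univ.erase i0, (G * √b * √(s i + b)) ≤ (G * √b * √2) ^ (d - 1) := by
    have : (Finset.univ.erase i0).card = d - 1 := by simp
    rw [← this, ← Finset.prod_const]
    refine Finset.prod_le_prod (fun i _ => by positivity) fun i _ => ?_
    have := (hs.1 i).2
    gcongr
    linarith
  calc _ ≤ G * √b * √(s i0 + b) * (G * √b * √2) ^ (d - 1) := by gcongr
    _ = _ := by
      obtain ⟨k, rfl⟩ : ∃ k, d = k + 1 := ⟨d - 1, by omega⟩
      simp only [Nat.add_sub_cancel]
      ring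

lemma box_log (d : ℕ) (hd : 1 ≤ d) (i0 : Fin d) (b : ℝ) (hb : 0 < b) :
    IntegrableOn (fun s : Fin d → ℝ => (s i0 + b)⁻¹) (Set.univ.pi fun _ => Set.Icc 0 (1 / (d:ℝ))) ∧
    ∫ s in Set.univ.pi fun _ : Fin d => Set.Icc 0 (1 / (d:ℝ)), (s i0 + b)⁻¹ =
      (1 / (d:ℝ)) ^ (d - 1) * Real.log (1 + 1 / (d * b)) := by
  have hd' : (1:ℝ) ≤ d := by exact_mod_cast hd
  have h0 : 0 ≤ 1 / (d:ℝ) := by positivity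
  constructor
  · apply ContinuousOn.integrableOn_compact (isCompact_univ_pi fun _ => isCompact_Icc)
    refine ContinuousOn.inv₀ (by fun_prop) fun s hs => ?_
    have := (hs i0 (Set.mem_univ _)).1
    positivity
  · rw [volume_pi, Measure.restrict_pi_pi]
    have e : ∀ s : Fin d → ℝ, (s i0 + b)⁻¹ = ∏ i, (if i = i0 then (s i + b)⁻¹ else 1) := by
      intro s; simp
    simp_rw [e]
    rw [integral_fintype_prod_eq_prod (𝕜 := ℝ) (f := fun (i : Fin d) (y : ℝ) => if i = i0 then (y + b)⁻¹ else 1),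
      ← Finset.mul_prod_erase _ _ (Finset.mem_univ i0), mul_comm]
    congr 1
    · rw [Finset.prod_congr rfl (g := fun _ => 1 / (d:ℝ))]
      · simp
      · intro i hi
        have : i ≠ i0 := (Finset.mem_erase.1 hi).1
        simp [this]
    · simp only [if_true]
      rw [integral_Icc_eq_integral_Ioc, ← intervalIntegral.integral_of_le h0,
        intervalIntegral.integral_comp_add_right (fun y => y⁻¹), integral_inv_of_pos (by linarith) (by linarith)]
      congr 1
      field_simp
      ring

lemma variance_lemma (d : ℕ) (hd : 1 ≤ d) (p β L : ℝ)
    (hp : 4 ≤ p) (hβ1 : 0 < β) (hβ2 : β ≤ 2) (hL : 0 < L) :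
    ∃ c b0 : ℝ, 0 < c ∧ 0 < b0 ∧ ∀ (n : ℕ) (b : ℝ), 1 ≤ n → 0 < b → b < 1 → b < b0 →
      ∃ f ∈ holderClass d β L,
        ((n:ℝ)⁻¹ * (√b ^ d)⁻¹) ^ (p / 2) * (c * Real.log (1 + 1 / (d * b))) ≤ lpRiskPow d n b p f := by
  obtain ⟨C1, hC1, hW⟩ := w_prod_le d hd
  have hd' : (1:ℝ) ≤ d := by exact_mod_cast hd
  have hi : 0 < d := hd
  set i0 : Fin d := ⟨0, hi⟩
  have hV := volR_pos d hd
  set W := (volR d)⁻¹ with hWdef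
  have hW0 : 0 < W := inv_pos.2 hV
  have h2 : 0 < √(2:ℝ) := Real.sqrt_pos.2 (by norm_num)
  set c2 := W / (8 * C1) with hc2
  have hc20 : 0 < c2 := by positivity
  refine ⟨c2 ^ (p / 2) * (2:ℝ) ^ (-(p / 4)) * (1 / (d:ℝ)) ^ (d - 1),
    (1 / (8 * C1 * √2 * W)) ^ 2, by positivity, by positivity, ?_⟩
  intro n b hn hb hb1 hb0
  have hE : |(0:ℝ)| ≤ 1 / 2 := by norm_num
  refine ⟨fam d i0 0 1 0, fam_holder d hd i0 0 1 0 β L hE one_pos hβ1 hβ2 (by simp [hL.le]), ?_⟩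
  obtain ⟨R, hRi, hR, hRs⟩ := risk_repr (fam_good d hd i0 0 1 0 hE) hn hb (p := p) (by linarith)
  have hsqb : 0 < √b := Real.sqrt_pos.2 hb
  have hsqb1 : √b ≤ 1 := Real.sqrt_le_one.2 hb1.le
  have hbs : √b ≤ 1 / (8 * C1 * √2 * W) := by
    rw [Real.sqrt_le_left (by positivity)]; exact hb0.le
  set B : Set (Fin d → ℝ) := Set.univ.pi fun _ => Set.Icc 0 (1 / (d:ℝ)) with hB
  have hBsub : B ⊆ Sd d := by
    intro s hs
    exact Sd_box_subset d hd s fun i => hs i (Set.mem_univ i)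
  have hBm : MeasurableSet B := MeasurableSet.univ_pi fun _ => measurableSet_Icc
  obtain ⟨hli, hlog⟩ := box_log d hd i0 b hb
  have hn0 : (0:ℝ) < n := by exact_mod_cast hn
  set Q := ((n:ℝ)⁻¹ * (√b ^ d)⁻¹) ^ (p / 2) with hQ
  have hQ0 : 0 < Q := by positivity
  have hpt : ∀ s ∈ B, Q * (c2 ^ (p / 2) * (2:ℝ) ^ (-(p / 4))) * (s i0 + b)⁻¹ ≤ R s := by
    intro s hs
    have hsS := hBsub hs
    obtain ⟨-, -, -, h⟩ := hRs s hsS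
    refine le_trans ?_ h
    have hA : famA d i0 0 1 0 = W := by simp [famA, hWdef]
    have e1 : ∀ x, dirKb d b s x * fam d i0 0 1 0 x = W * dirKb d b s x := by
      intro x; rw [kb_mul_fam, hA]; ring
    have e2 : ∀ x, dirKb d b s x ^ 2 * fam d i0 0 1 0 x = W * dirKb d b s x ^ 2 := by
      intro x; rw [sq, mul_assoc, e1]; ring
    simp_rw [e1, e2]
    rw [integral_const_mul, integral_const_mul, kb_integral hb hsS, mul_one]
    have hs0 : 0 ≤ s i0 := (hsS.1 i0).1
    have hs1 : s i0 ≤ 1 := (hsS.1 i0).2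
    have hsp : 0 < s i0 + b := by linarith
    set r := √(s i0 + b) with hr
    have hr0 : 0 < r := Real.sqrt_pos.2 hsp
    have hr2 : r ≤ √2 := Real.sqrt_le_sqrt (by linarith)
    have hwp := hW b s i0 hb hb1 hsS
    have hsq := kb_sq_lower hd hb hb1 hsS
    have hPpos : 0 < ∏ i, (2 * √(2 * d * ((d:ℝ) + 3) ^ 2 * (b * (s i + b)))) := by
      refine Finset.prod_pos fun i _ => ?_
      have h3 : 0 < s i + b := by have := (hsS.1 i).1; linarith
      have := Real.sqrt_pos.2 (show 0 < 2 * d * ((d:ℝ) + 3) ^ 2 * (b * (s i + b)) by positivity)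
      positivity
    have hsq2 : 1 / (4 * (C1 * √b ^ d * r)) ≤ ∫ x, dirKb d b s x ^ 2 := by
      refine le_trans ?_ hsq
      gcongr
    have hbd : √b ^ d ≤ √b := by
      calc √b ^ d ≤ √b ^ 1 := pow_le_pow_of_le_one hsqb.le hsqb1 hd
        _ = √b := pow_one _
    have hden : 8 * C1 * W * (√b ^ d * r) ≤ 1 := by
      calc 8 * C1 * W * (√b ^ d * r) ≤ 8 * C1 * W * (1 / (8 * C1 * √2 * W) * √2) := by
            gcongr; exact hbd.trans hbs
        _ = 1 := by field_simp
    have hvar : c2 * ((√b ^ d)⁻¹ * r⁻¹) ≤ W * (∫ x, dirKb d b s x ^ 2) - W ^ 2 := by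
      have k1 : W * (1 / (4 * (C1 * √b ^ d * r))) ≤ W * ∫ x, dirKb d b s x ^ 2 := by gcongr
      have k2 : W * (1 / (4 * (C1 * √b ^ d * r))) = 2 * (c2 * ((√b ^ d)⁻¹ * r⁻¹)) := by
        rw [hc2]; field_simp; norm_num
      have k3 : W ^ 2 ≤ c2 * ((√b ^ d)⁻¹ * r⁻¹) := by
        have : c2 * ((√b ^ d)⁻¹ * r⁻¹) = W / (8 * C1 * (√b ^ d * r)) := by
          rw [hc2]; field_simp
        rw [this, le_div_iff₀ (by positivity)]
        nlinarith
      linarith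
    have hrp : (r⁻¹) ^ (p / 2) = (s i0 + b) ^ (-(p / 4)) := by
      rw [hr, Real.sqrt_eq_rpow, ← Real.rpow_neg hsp.le, ← Real.rpow_mul hsp.le]
      congr 1; ring
    have hpow : (2:ℝ) ^ (-(p / 4)) * (s i0 + b)⁻¹ ≤ (s i0 + b) ^ (-(p / 4)) := by
      set t := (s i0 + b) / 2 with ht
      have ht0 : 0 < t := by positivity
      have ht1 : t ≤ 1 := by rw [ht]; linarith
      have es : s i0 + b = 2 * t := by rw [ht]; ring
      have k4 : t ^ (-1:ℝ) ≤ t ^ (-(p / 4)) :=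
        Real.rpow_le_rpow_of_exponent_ge ht0 ht1 (by linarith)
      rw [Real.rpow_neg_one] at k4
      rw [es, Real.mul_rpow (by norm_num) ht0.le]
      have k5 : (2 * t)⁻¹ ≤ t⁻¹ := by gcongr; linarith
      gcongr
      exact k5.trans k4
    calc Q * (c2 ^ (p / 2) * (2:ℝ) ^ (-(p / 4))) * (s i0 + b)⁻¹
        = Q * c2 ^ (p / 2) * ((2:ℝ) ^ (-(p / 4)) * (s i0 + b)⁻¹) := by ring
      _ ≤ Q * c2 ^ (p / 2) * (r⁻¹) ^ (p / 2) := by rw [hrp]; gcongr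
      _ = ((n:ℝ)⁻¹ * (c2 * ((√b ^ d)⁻¹ * r⁻¹))) ^ (p / 2) := by
        rw [hQ, ← Real.mul_rpow (by positivity) (by positivity), ← Real.mul_rpow (by positivity) (by positivity)]
        congr 1; ring
      _ ≤ _ := by gcongr
  rw [hR]
  calc _ = ∫ s in B, Q * (c2 ^ (p / 2) * (2:ℝ) ^ (-(p / 4))) * (s i0 + b)⁻¹ := by
        rw [integral_const_mul, hlog]; ring
    _ ≤ ∫ s in B, R s := setIntegral_mono_on (hli.const_mul _) (hRi.mono_set hBsub) hBm hpt
    _ ≤ _ := by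
      refine setIntegral_mono_set hRi ?_ hBsub.eventuallyLE
      exact (ae_restrict_iff' (measurableSet_Sd d)).2 (Eventually.of_forall fun s hs => (hRs s hs).1)


lemma final_real (d : ℕ) (hd : 1 ≤ d) (p β L : ℝ)
    (hp : 4 ≤ p) (hβ1 : 0 < β) (hβ2 : β ≤ 2) (hL : 0 < L)
    (b : ℕ → ℝ) (hb : ∀ n, b n ∈ Set.Ioo (0 : ℝ) 1) (M : ℝ) (hM : 0 < M) :
    ∀ᶠ n : ℕ in atTop, ∃ f ∈ holderClass d β L,
      (M * (n : ℝ) ^ (-β / ((d : ℝ) + 2 * β))) ^ p ≤ lpRiskPow d n (b n) p f := by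
  obtain ⟨c, hc, hbias⟩ := bias_lemma d hd p β L hp hβ1 hβ2 hL
  obtain ⟨c', b0, hc', hb0, hvar⟩ := variance_lemma d hd p β L hp hβ1 hβ2 hL
  have hd' : (1:ℝ) ≤ d := by exact_mod_cast hd
  set q : ℝ := (d:ℝ) + 2 * β with hq
  have hq0 : 0 < q := by positivity
  set A : ℝ := (M / c) ^ (2 / β) with hA
  have hA0 : 0 < A := by positivity
  have hAβ : c * A ^ (β / 2) = M := by
    rw [hA, ← Real.rpow_mul (by positivity)]
    have : 2 / β * (β / 2) = 1 := by field_simp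
    rw [this, Real.rpow_one]; field_simp
  set T : ℝ := M ^ p / ((A ^ (-((d:ℝ) / 2))) ^ (p / 2) * c') with hT
  have hT0 : 0 < T := by positivity
  set δ : ℝ := 1 / (d * Real.exp T) with hδ
  have hδ0 : 0 < δ := by positivity
  have hlim : Tendsto (fun n : ℕ => A * (n:ℝ) ^ (-(2 / q))) atTop (𝓝 0) := by
    have h1 := (tendsto_rpow_neg_atTop (show 0 < 2 / q by positivity)).comp tendsto_natCast_atTop_atTop
    simpa using h1.const_mul A
  filter_upwards [hlim.eventually (gt_mem_nhds hδ0), hlim.eventually (gt_mem_nhds hb0),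
    eventually_ge_atTop 1] with n h1 h2 hn
  have hn0 : (0:ℝ) < n := by exact_mod_cast hn
  obtain ⟨hbp, hb1⟩ := hb n
  by_cases hcase : A * (n:ℝ) ^ (-(2 / q)) ≤ b n
  · obtain ⟨f, hf, hr⟩ := hbias n (b n) hn hbp hb1
    refine ⟨f, hf, le_trans ?_ hr⟩
    have e : M * (n:ℝ) ^ (-β / q) = c * (A * (n:ℝ) ^ (-(2 / q))) ^ (β / 2) := by
      rw [Real.mul_rpow hA0.le (by positivity), ← Real.rpow_mul hn0.le, ← mul_assoc, hAβ]
      congr 2; field_simp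
    rw [e]
    gcongr
  · push Not at hcase
    obtain ⟨f, hf, hr⟩ := hvar n (b n) hn hbp hb1 (hcase.trans h2)
    refine ⟨f, hf, le_trans ?_ hr⟩
    have hlog : T ≤ Real.log (1 + 1 / (d * b n)) := by
      rw [Real.le_log_iff_exp_le (by positivity)]
      have h3 : b n ≤ δ := (hcase.trans h1).le
      have h4 : 1 / (d * δ) ≤ 1 / (d * b n) := by gcongr
      have h5 : 1 / (d * δ) = Real.exp T := by rw [hδ]; field_simp
      linarith
    have hsq : √(b n) ^ d ≤ (A * (n:ℝ) ^ (-(2 / q))) ^ ((d:ℝ) / 2) := by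
      have : √(b n) ^ d = (b n) ^ ((d:ℝ) / 2) := by
        rw [Real.sqrt_eq_rpow, ← Real.rpow_natCast, ← Real.rpow_mul hbp.le]; congr 1; ring
      rw [this]
      gcongr
    have hsp : 0 < √(b n) := Real.sqrt_pos.2 hbp
    have hinv : A ^ (-((d:ℝ) / 2)) * (n:ℝ) ^ (2 * (-β / q)) ≤ (n:ℝ)⁻¹ * (√(b n) ^ d)⁻¹ := by
      calc A ^ (-((d:ℝ) / 2)) * (n:ℝ) ^ (2 * (-β / q))
          = (n:ℝ)⁻¹ * ((A * (n:ℝ) ^ (-(2 / q))) ^ ((d:ℝ) / 2))⁻¹ := by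
            rw [Real.mul_rpow hA0.le (by positivity), ← Real.rpow_mul hn0.le, mul_inv,
              ← Real.rpow_neg hA0.le, ← Real.rpow_neg hn0.le, ← Real.rpow_neg_one (n:ℝ),
              mul_left_comm, ← Real.rpow_add hn0]
            congr 2
            field_simp
            rw [hq]; ring
        _ ≤ _ := by gcongr
    calc (M * (n:ℝ) ^ (-β / q)) ^ p
        = (A ^ (-((d:ℝ) / 2)) * (n:ℝ) ^ (2 * (-β / q))) ^ (p / 2) * (c' * T) := by
          rw [Real.mul_rpow hM.le (by positivity), Real.mul_rpow (by positivity) (by positivity),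
            ← Real.rpow_mul hn0.le, ← Real.rpow_mul hn0.le]
          have : 2 * (-β / q) * (p / 2) = -β / q * p := by ring
          rw [this, hT]
          field_simp
      _ ≤ _ := by gcongr

/-- Proposition 3.2: for `p ∈ [4,∞)` and `β ∈ (0,2]`, whatever the
bandwidth sequence `b_n ∈ (0,1)`, the Dirichlet kernel density estimator is never minimax
over `Σ(d,β,L)`: the ratio of its risk to the minimax rate `n^{-β/(d+2β)}` has liminf `∞`. -/
theorem dirichlet_not_minimax_p_ge_four (d : ℕ) (hd : 1 ≤ d) (p β L : ℝ)
    (hp : 4 ≤ p) (hβ1 : 0 < β) (hβ2 : β ≤ 2) (hL : 0 < L)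
    (b : ℕ → ℝ) (hb : ∀ n, b n ∈ Set.Ioo (0 : ℝ) 1) :
    Filter.liminf
      (fun n : ℕ =>
        (⨆ f ∈ holderClass d β L,
            ENNReal.ofReal ((lpRiskPow d n (b n) p f) ^ (1 / p))) /
          ENNReal.ofReal ((n : ℝ) ^ (-β / ((d : ℝ) + 2 * β))))
      Filter.atTop = ⊤ := by
  have hp0 : (0:ℝ) < p := by linarith
  refine ENNReal.eq_top_of_forall_nnreal_le fun r => ?_
  refine le_liminf_of_le (by isBoundedDefault) ?_
  have hM : (0:ℝ) < (r:ℝ) + 1 := by positivity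
  filter_upwards [final_real d hd p β L hp hβ1 hβ2 hL b hb ((r:ℝ) + 1) hM,
    eventually_ge_atTop 1] with n hf hn
  obtain ⟨f, hfm, hfr⟩ := hf
  have hn0 : (0:ℝ) < n := by exact_mod_cast hn
  set t := (n : ℝ) ^ (-β / ((d : ℝ) + 2 * β)) with ht
  have ht0 : 0 < t := by positivity
  rw [ENNReal.le_div_iff_mul_le (Or.inl (by simpa using ht0)) (Or.inl ENNReal.ofReal_ne_top)]
  refine le_trans ?_ (le_iSup₂ (f := fun f _ => ENNReal.ofReal ((lpRiskPow d n (b n) p f) ^ (1 / p))) f hfm)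
  rw [← ENNReal.ofReal_coe_nnreal, ← ENNReal.ofReal_mul r.coe_nonneg]
  apply ENNReal.ofReal_le_ofReal
  calc (r:ℝ) * t ≤ ((r:ℝ) + 1) * t := by gcongr; linarith
    _ = ((((r:ℝ) + 1) * t) ^ p) ^ (1 / p) := by
      rw [← Real.rpow_mul (by positivity), mul_one_div_cancel (ne_of_gt hp0), Real.rpow_one]
    _ ≤ _ := by gcongr
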